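/- arXiv:1507.04659 — 2 statements merged into one kernel-verified Lean document; each statement's English description precedes it below -/
import Mathlib

section
/- Let T > 0, let φ : ℝ → ℝ be continuous and nondecreasing, let μ be a Lévy measure on ℝ^N \ {0}, and let u₀ ∈ L^∞(ℝ^N). If u and û are both distributional solutions of the initial value problem ∂_t v − L^μ[φ(v)] = 0 in Q_T with initial datum u₀, and both satisfy v ∈ L^∞(Q_T) and v − u₀ ∈ L¹(Q_T), then u = û a.e. in Q_T. -/
open MeasureTheory Set Filter

noncomputable section

/-- Euclidean space `ℝ^N`. -/
abbrev Euc (N : ℕ) := EuclideanSpace ℝ (Fin N)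

variable {N : ℕ}

/-- `μ` is a (symmetric) Lévy measure on `ℝ^N ∖ {0}` : it is a nonnegative measure giving no
mass to `{0}`, symmetric (`μ(−B) = μ(B)`), and `∫ min(|z|²,1) dμ(z) < ∞`. -/
def IsLevyMeasure (μ : Measure (Euc N)) : Prop :=
  μ {0} = 0 ∧ μ.map (fun z => -z) = μ ∧
    ∫⁻ z, ENNReal.ofReal (min (‖z‖ ^ 2) 1) ∂μ ≠ ⊤

/-- The nonlocal operator
`L^μ[ψ](x) = ∫ (ψ(x+z) − ψ(x) − z·Dψ(x) 1_{|z|≤1}) dμ(z)`. -/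
def Lop (μ : Measure (Euc N)) (ψ : Euc N → ℝ) (x : Euc N) : ℝ :=
  ∫ z, (ψ (x + z) - ψ x - (if ‖z‖ ≤ 1 then fderiv ℝ ψ x z else 0)) ∂μ

/-- `ψ ∈ C_c^∞(ℝ^N)`. -/
def IsTestFn (ψ : Euc N → ℝ) : Prop :=
  ContDiff ℝ (⊤ : ℕ∞) ψ ∧ HasCompactSupport ψ

/-- `ψ ∈ C_c^∞(ℝ^N × [0,T))` : smooth, compactly supported, and the support stays away
from `t = T` (but may touch `t = 0`). -/
def IsSTTestFn (T : ℝ) (ψ : Euc N → ℝ → ℝ) : Prop :=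
  ContDiff ℝ (⊤ : ℕ∞) (Function.uncurry ψ) ∧ HasCompactSupport (Function.uncurry ψ) ∧
    tsupport (Function.uncurry ψ) ⊆ {p : Euc N × ℝ | p.2 < T}

/-- `ψ ∈ C_c^∞(Q_T)` : smooth, compactly supported inside the open cylinder
`ℝ^N × (0,T)`. -/
def IsIntTestFn (T : ℝ) (ψ : Euc N → ℝ → ℝ) : Prop :=
  ContDiff ℝ (⊤ : ℕ∞) (Function.uncurry ψ) ∧ HasCompactSupport (Function.uncurry ψ) ∧
    tsupport (Function.uncurry ψ) ⊆ {p : Euc N × ℝ | 0 < p.2 ∧ p.2 < T}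

/-- The natural measure on the cylinder `Q_T = ℝ^N × (0,T)`. -/
def QTvol (N : ℕ) (T : ℝ) : Measure (Euc N × ℝ) :=
  (volume : Measure (Euc N)).prod ((volume : Measure ℝ).restrict (Ioo 0 T))

/-- `u ∈ L^∞(Q_T)`. -/
def MemLinfQT (T : ℝ) (u : Euc N → ℝ → ℝ) : Prop :=
  AEStronglyMeasurable (fun p : Euc N × ℝ => u p.1 p.2) (QTvol N T) ∧
    ∃ C : ℝ, ∀ᵐ p ∂(QTvol N T), |u p.1 p.2| ≤ C

/-- `u ∈ L¹(Q_T)`. -/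
def MemL1QT (T : ℝ) (u : Euc N → ℝ → ℝ) : Prop :=
  Integrable (fun p : Euc N × ℝ => u p.1 p.2) (QTvol N T)

/-- `u ∈ C([0,T]; L¹_loc(ℝ^N))` : for every compact `K`, `t ↦ u(·,t)` is continuous
from `[0,T]` into `L¹(K)`. -/
def MemCL1loc (T : ℝ) (u : Euc N → ℝ → ℝ) : Prop :=
  ∀ K : Set (Euc N), IsCompact K →
    (∀ t ∈ Icc (0 : ℝ) T, IntegrableOn (fun x => u x t) K) ∧
    ∀ t ∈ Icc (0 : ℝ) T,
      Tendsto (fun s => ∫ x in K, |u x s - u x t|) (nhdsWithin t (Icc 0 T)) (nhds 0)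

/-- `u` is a distributional solution of `∂_t u − A[φ(u)] = 0` in `Q_T` with initial
datum `u0` : for all `ψ ∈ C_c^∞(ℝ^N × [0,T))`,
`∫₀^T ∫ (u ∂_t ψ + φ(u) A[ψ(·,t)]) dx dt + ∫ u0(x) ψ(x,0) dx = 0`. -/
def IsDistSolOp (T : ℝ) (A : (Euc N → ℝ) → Euc N → ℝ) (φ : ℝ → ℝ)
    (u0 : Euc N → ℝ) (u : Euc N → ℝ → ℝ) : Prop :=
  ∀ ψ : Euc N → ℝ → ℝ, IsSTTestFn T ψ →
    (∫ t in Ioo (0 : ℝ) T, ∫ x,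
        (u x t * deriv (ψ x) t + φ (u x t) * A (fun y => ψ y t) x))
      + ∫ x, u0 x * ψ x 0 = 0

/-- `u0 ∈ L^∞(ℝ^N)`. -/
def MemLinfRn (u0 : Euc N → ℝ) : Prop :=
  AEStronglyMeasurable u0 (volume : Measure (Euc N)) ∧
    ∃ C : ℝ, ∀ᵐ x : Euc N ∂volume, |u0 x| ≤ C

end

namespace LevyUniqueness

open scoped Topology ENNReal

variable {N : ℕ} {μ : Measure (Euc N)}

theorem integrable_levyWeight (hμ : IsLevyMeasure μ) :
    Integrable (fun z : Euc N => min (‖z‖ ^ 2) 1) μ := by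
  refine ⟨by fun_prop, ?_⟩
  rw [hasFiniteIntegral_iff_ofReal (Eventually.of_forall fun z => by positivity)]
  exact lt_top_iff_ne_top.2 hμ.2.2

theorem sFinite_of_isLevyMeasure (hμ : IsLevyMeasure μ) : SFinite μ := by
  set f : Euc N → ℝ≥0∞ := fun z => ENNReal.ofReal (min (‖z‖ ^ 2) 1) with hf
  have hfm : Measurable f := by fun_prop
  have hfin : IsFiniteMeasure (μ.withDensity f) := isFiniteMeasure_withDensity hμ.2.2
  have h0 : ∀ᵐ z ∂μ, f z ≠ 0 := by
    have : ∀ᵐ z ∂μ, z ≠ 0 := by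
      rw [ae_iff]; simpa using hμ.1
    filter_upwards [this] with z hz
    simp [hf, hz]
  rw [← withDensity_inv_same hfm h0 (Eventually.of_forall fun z => ENNReal.ofReal_ne_top)]
  infer_instance

theorem integrable_of_le_levyWeight (hμ : IsLevyMeasure μ) {f : Euc N → ℝ}
    (hf : AEStronglyMeasurable f μ) (C : ℝ) (h : ∀ z, |f z| ≤ C * min (‖z‖ ^ 2) 1) :
    Integrable f μ :=
  ((integrable_levyWeight hμ).const_mul C).mono' hf (Eventually.of_forall h)

/-- The symmetric second difference `f(x+z) + f(x-z) - 2 f(x)`. -/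
noncomputable def secondDiff (f : Euc N → ℝ) (z x : Euc N) : ℝ := f (x + z) + f (x - z) - 2 * f x

/-- The operator `L^μ` written with symmetric second differences. -/
noncomputable def symLop (μ : Measure (Euc N)) (f : Euc N → ℝ) (x : Euc N) : ℝ :=
  1 / 2 * ∫ z, secondDiff f z x ∂μ

theorem exists_taylor_bound {η : Euc N → ℝ} (hη : IsTestFn η) :
    ∃ K : ℝ, 0 ≤ K ∧ ∀ x z, |η (x + z) - η x - fderiv ℝ η x z| ≤ K * ‖z‖ ^ 2 := by
  have hd : ContDiff ℝ 1 (fderiv ℝ η) := (contDiff_infty.1 hη.1 2).fderiv_right (by norm_num)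
  obtain ⟨K, hK⟩ := hd.lipschitzWith_of_hasCompactSupport (hη.2.fderiv (𝕜 := ℝ)) one_ne_zero
  refine ⟨K, K.2, fun x z => ?_⟩
  have hdiff : Differentiable ℝ η := hη.1.differentiable (by simp)
  have key := (convex_segment x (x + z)).norm_image_sub_le_of_norm_hasFDerivWithin_le'
    (f := η) (f' := fderiv ℝ η) (φ := fderiv ℝ η x) (C := K * ‖z‖)
    (fun y _ => (hdiff y).hasFDerivAt.hasFDerivWithinAt) (fun y hy => ?_)
    (left_mem_segment ℝ _ _) (right_mem_segment ℝ _ _)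
  · simp only [add_sub_cancel_left, Real.norm_eq_abs] at key
    calc _ ≤ _ := key
      _ = _ := by ring
  · have h1 := hK.dist_le_mul y x
    rw [dist_eq_norm, dist_eq_norm] at h1
    refine h1.trans (mul_le_mul_of_nonneg_left ?_ K.2)
    have := norm_sub_le_of_mem_segment hy
    simpa using this

theorem exists_bound {η : Euc N → ℝ} (hη : IsTestFn η) : ∃ B : ℝ, 0 ≤ B ∧ ∀ x, |η x| ≤ B := by
  obtain ⟨B, hB⟩ := hη.2.exists_bound_of_continuous hη.1.continuous
  exact ⟨B, (norm_nonneg _).trans (hB 0), hB⟩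

theorem exists_compensated_bound {η : Euc N → ℝ} (hη : IsTestFn η) :
    ∃ C : ℝ, 0 ≤ C ∧ ∀ x z, |η (x + z) - η x - (if ‖z‖ ≤ 1 then fderiv ℝ η x z else 0)|
      ≤ C * min (‖z‖ ^ 2) 1 := by
  obtain ⟨K, hK0, hK⟩ := exists_taylor_bound hη
  obtain ⟨B, hB0, hB⟩ := exists_bound hη
  refine ⟨K + 2 * B, by positivity, fun x z => ?_⟩
  split_ifs with hz
  · rw [min_eq_left (pow_le_one₀ (norm_nonneg _) hz)]
    nlinarith [hK x z, sq_nonneg ‖z‖]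
  · rw [min_eq_right (one_le_pow₀ (not_le.1 hz).le)]
    have h1 := hB (x + z)
    have h2 := hB x
    have h3 := abs_sub (η (x + z)) (η x)
    rw [sub_zero]
    linarith

theorem Lop_eq_symLop (hμ : IsLevyMeasure μ) {η : Euc N → ℝ} (hη : IsTestFn η) :
    Lop μ η = symLop μ η := by
  funext x
  obtain ⟨C, -, hC⟩ := exists_compensated_bound hη
  set g : Euc N → ℝ := fun z => η (x + z) - η x - (if ‖z‖ ≤ 1 then fderiv ℝ η x z else 0)
  have hηc := hη.1.continuous
  have hgm : Measurable g := by
    refine Measurable.sub (by fun_prop) (Measurable.ite ?_ (by fun_prop) (by fun_prop))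
    exact measurableSet_le (by fun_prop) (by fun_prop)
  have hg : Integrable g μ := integrable_of_le_levyWeight hμ hgm.aestronglyMeasurable C (hC x)
  have hneg : MeasurePreserving (fun z : Euc N => -z) μ μ := ⟨by fun_prop, hμ.2.1⟩
  have hemb : MeasurableEmbedding (fun z : Euc N => -z) :=
    (MeasurableEquiv.neg (Euc N)).measurableEmbedding
  have h1 : ∫ z, g (-z) ∂μ = ∫ z, g z ∂μ := hneg.integral_comp hemb g
  have hg' : Integrable (fun z => g (-z)) μ := (hneg.integrable_comp_emb hemb).2 hg
  have h2 : ∫ z, secondDiff η z x ∂μ = ∫ z, (g z + g (-z)) ∂μ := by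
    refine integral_congr_ae (Eventually.of_forall fun z => ?_)
    simp only [g, secondDiff, norm_neg, map_neg]
    split_ifs <;> simp only [sub_eq_add_neg] <;> ring
  rw [symLop, h2, integral_add hg hg', h1]
  simp only [Lop, g]
  ring

theorem exists_secondDiff_bound {η : Euc N → ℝ} (hη : IsTestFn η) :
    ∃ K : ℝ, 0 ≤ K ∧ ∀ z x, |secondDiff η z x| ≤ K * ‖z‖ ^ 2 := by
  obtain ⟨K, hK0, hK⟩ := exists_taylor_bound hη
  refine ⟨2 * K, by positivity, fun z x => ?_⟩
  have h1 := hK x z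
  have h2 := hK x (-z)
  rw [norm_neg, map_neg, ← sub_eq_add_neg] at h2
  have h3 := abs_add_le (η (x + z) - η x - fderiv ℝ η x z) (η (x - z) - η x - -fderiv ℝ η x z)
  have h4 : secondDiff η z x
      = (η (x + z) - η x - fderiv ℝ η x z) + (η (x - z) - η x - -fderiv ℝ η x z) := by
    simp only [secondDiff]; ring
  rw [h4]; linarith

theorem integrable_testFn {η : Euc N → ℝ} (hη : IsTestFn η) : Integrable η :=
  hη.1.continuous.integrable_of_hasCompactSupport hη.2

theorem measurable_secondDiff_uncurry {f : Euc N → ℝ} (hf : Measurable f) :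
    Measurable (fun p : Euc N × Euc N => secondDiff f p.1 p.2) := by
  unfold secondDiff; fun_prop

theorem integrable_secondDiff {f : Euc N → ℝ} (hf : Integrable f) (z : Euc N) :
    Integrable (secondDiff f z) :=
  ((hf.comp_add_right z).add (hf.comp_sub_right z)).sub (hf.const_mul 2)

theorem exists_integral_secondDiff_bound {η : Euc N → ℝ} (hη : IsTestFn η) :
    ∃ C : ℝ, 0 ≤ C ∧ ∀ z, ∫ x, |secondDiff η z x| ≤ C * min (‖z‖ ^ 2) 1 := by
  obtain ⟨K, hK0, hK⟩ := exists_secondDiff_bound hη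
  obtain ⟨R, hR⟩ := hη.2.isBounded.subset_closedBall 0
  have hint := integrable_testFn hη
  set v := volume.real (Metric.closedBall (0 : Euc N) (R + 1))
  refine ⟨K * v + 4 * ∫ x, |η x|, by positivity, fun z => ?_⟩
  have hI : 0 ≤ ∫ x, |η x| := integral_nonneg fun x => abs_nonneg _
  have hv : 0 ≤ v := measureReal_nonneg
  by_cases hz : ‖z‖ ≤ 1
  · rw [min_eq_left (pow_le_one₀ (norm_nonneg _) hz)]
    have hzero : ∀ y : Euc N, R < ‖y‖ → η y = 0 := fun y hy => by
      by_contra h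
      have := hR (subset_tsupport _ h)
      rw [mem_closedBall_zero_iff] at this
      linarith
    have hsupp : ∀ x, x ∉ Metric.closedBall (0 : Euc N) (R + 1) → |secondDiff η z x| = 0 := by
      intro x hx
      rw [mem_closedBall_zero_iff, not_le] at hx
      have h1 : ‖x‖ ≤ ‖x + z‖ + ‖z‖ := by simpa using norm_sub_le (x + z) z
      have h2 : ‖x‖ ≤ ‖x - z‖ + ‖z‖ := by simpa using norm_add_le (x - z) z
      simp [secondDiff, hzero x (by linarith), hzero (x + z) (by linarith),
        hzero (x - z) (by linarith)]
    rw [← setIntegral_eq_integral_of_forall_compl_eq_zero hsupp]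
    have h1 : ∫ x in Metric.closedBall (0 : Euc N) (R + 1), |secondDiff η z x|
        ≤ ∫ x in Metric.closedBall (0 : Euc N) (R + 1), K * ‖z‖ ^ 2 := by
      refine setIntegral_mono ((integrable_secondDiff hint z).abs.integrableOn) ?_ (hK z)
      exact integrableOn_const (isCompact_closedBall _ _).measure_lt_top.ne
    rw [setIntegral_const, smul_eq_mul] at h1
    change _ ≤ v * _ at h1
    nlinarith [sq_nonneg ‖z‖]
  · rw [min_eq_right (one_le_pow₀ (not_le.1 hz).le)]
    have h1 : ∫ x, |secondDiff η z x| ≤ ∫ x, (|η (x + z)| + |η (x - z)| + 2 * |η x|) := by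
      refine integral_mono (integrable_secondDiff hint z).abs
        (((hint.comp_add_right z).abs.add (hint.comp_sub_right z).abs).add
          (hint.abs.const_mul 2)) fun x => ?_
      simp only [secondDiff]
      calc _ ≤ |η (x + z) + η (x - z)| + |2 * η x| := abs_sub _ _
        _ ≤ _ := by
          rw [abs_mul, abs_two]
          gcongr
          exact abs_add_le _ _
    have h2 : Integrable fun x => |η (x + z)| + |η (x - z)| :=
      (hint.comp_add_right z).abs.add (hint.comp_sub_right z).abs
    rw [integral_add h2 (hint.abs.const_mul 2), integral_add (hint.comp_add_right z).abs
      (hint.comp_sub_right z).abs, integral_const_mul,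
      integral_add_right_eq_self (fun x => |η x|) z,
      integral_sub_right_eq_self (fun x => |η x|) z] at h1
    nlinarith [mul_nonneg hK0 hv]

theorem integrable_secondDiff_uncurry (hμ : IsLevyMeasure μ) {η : Euc N → ℝ} (hη : IsTestFn η) :
    Integrable (fun p : Euc N × Euc N => secondDiff η p.1 p.2) (μ.prod volume) := by
  have := sFinite_of_isLevyMeasure hμ
  obtain ⟨C, -, hC⟩ := exists_integral_secondDiff_bound hη
  have hm := measurable_secondDiff_uncurry hη.1.continuous.measurable
  rw [integrable_prod_iff hm.aestronglyMeasurable]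
  refine ⟨Eventually.of_forall fun z => integrable_secondDiff (integrable_testFn hη) z, ?_⟩
  refine integrable_of_le_levyWeight hμ ?_ C fun z => ?_
  · exact hm.stronglyMeasurable.norm.integral_prod_right'.aestronglyMeasurable
  · rw [abs_of_nonneg (integral_nonneg fun _ => norm_nonneg _)]
    exact hC z

theorem integrable_symLop (hμ : IsLevyMeasure μ) {η : Euc N → ℝ} (hη : IsTestFn η) :
    Integrable (symLop μ η) := by
  have := sFinite_of_isLevyMeasure hμ
  exact (integrable_secondDiff_uncurry hμ hη).integral_prod_right.const_mul _

theorem measurable_symLop [SFinite μ] {f : Euc N → ℝ} (hf : Measurable f) :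
    Measurable (symLop μ f) :=
  ((measurable_secondDiff_uncurry hf).stronglyMeasurable.integral_prod_left'.measurable).const_mul _

theorem ofReal_integral_le_lintegral_ofReal {α : Type*} [MeasurableSpace α] {ν : Measure α}
    {f : α → ℝ} (hf : Integrable f ν) :
    ENNReal.ofReal (∫ x, f x ∂ν) ≤ ∫⁻ x, ENNReal.ofReal (f x) ∂ν := by
  have h1 : ∫ x, f x ∂ν ≤ ∫ x, max (f x) 0 ∂ν :=
    integral_mono hf hf.pos_part fun x => le_max_left _ _
  refine (ENNReal.ofReal_le_ofReal h1).trans ?_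
  rw [ofReal_integral_eq_lintegral_ofReal hf.pos_part
    (Eventually.of_forall fun x => le_max_right _ _)]
  refine lintegral_mono fun x => ?_
  rcases le_total (f x) 0 with h | h <;> simp [h]

/-- Soft thresholding at level `k`. -/
noncomputable def softThreshold (k a : ℝ) : ℝ := a - max (-k) (min k a)

theorem continuous_softThreshold (k : ℝ) : Continuous (softThreshold k) := by
  unfold softThreshold; fun_prop

theorem abs_softThreshold_sub_le {k : ℝ} (hk : 0 ≤ k) (a : ℝ) : |softThreshold k a - a| ≤ k := by
  simp only [softThreshold, sub_sub_cancel_left, abs_neg]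
  rw [abs_le]
  exact ⟨le_max_left _ _, max_le (by linarith) (min_le_left _ _)⟩

theorem softThreshold_eq_zero {k a : ℝ} (h : |a| ≤ k) : softThreshold k a = 0 := by
  rw [abs_le] at h
  simp [softThreshold, h.1, h.2]

theorem abs_softThreshold_le {k : ℝ} (hk : 0 ≤ k) (a : ℝ) : |softThreshold k a| ≤ |a| := by
  unfold softThreshold
  rcases le_total k a with h | h <;> rcases le_total (-k) a with h' | h' <;>
    simp [h, h', abs_le] <;> grind

theorem softThreshold_mono_lipschitz {k a b : ℝ} (h : a ≤ b) :
    0 ≤ softThreshold k b - softThreshold k a ∧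
      softThreshold k b - softThreshold k a ≤ b - a := by
  simp only [softThreshold]
  constructor
  · have : max (-k) (min k b) ≤ max (-k) (min k a) + (b - a) := by
      rw [max_le_iff]
      refine ⟨by linarith [le_max_left (-k) (min k a)], ?_⟩
      have h2 := le_max_right (-k) (min k a)
      have h3 : min k b ≤ min k a + (b - a) := by
        rcases le_total k a with h4 | h4
        · rw [min_eq_left h4]; linarith [min_le_left k b]
        · rw [min_eq_right h4]; linarith [min_le_right k b]
      linarith
    linarith
  · have : max (-k) (min k a) ≤ max (-k) (min k b) := by gcongr
    linarith

theorem sq_softThreshold_sub_le_mul (k a b : ℝ) :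
    (softThreshold k b - softThreshold k a) ^ 2 ≤
      (b - a) * (softThreshold k b - softThreshold k a) := by
  rcases le_total a b with h | h
  · obtain ⟨h1, h2⟩ := softThreshold_mono_lipschitz (k := k) h
    nlinarith
  · obtain ⟨h1, h2⟩ := softThreshold_mono_lipschitz (k := k) h
    nlinarith

theorem sq_softThreshold_sub_le_sq (k a b : ℝ) :
    (softThreshold k b - softThreshold k a) ^ 2 ≤ (b - a) ^ 2 := by
  rcases le_total a b with h | h
  · obtain ⟨h1, h2⟩ := softThreshold_mono_lipschitz (k := k) h
    nlinarith
  · obtain ⟨h1, h2⟩ := softThreshold_mono_lipschitz (k := k) h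
    nlinarith

/-- `V` is a bounded function vanishing at infinity in measure, with controlled second
differences, and `W` is an integrable version of `L^μ[V]`. -/
structure IsPotential (μ : Measure (Euc N)) (V W : Euc N → ℝ) : Prop where
  measurable : Measurable V
  bounded : ∃ B, ∀ x, |V x| ≤ B
  secondDiff_le : ∃ C, ∀ z x, |secondDiff V z x| ≤ C * min (‖z‖ ^ 2) 1
  volume_lt_top : ∀ k > 0, volume {x | k < |V x|} < ⊤
  integrable : Integrable W
  ae_eq : W =ᵐ[volume] symLop μ V

theorem IsPotential.zero : IsPotential μ 0 0 where
  measurable := measurable_const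
  bounded := ⟨0, by simp⟩
  secondDiff_le := ⟨0, by simp [secondDiff]⟩
  volume_lt_top k hk := by simp [not_lt.2 hk.le]
  integrable := integrable_zero _ _ _
  ae_eq := Eventually.of_forall fun x => by simp [symLop, secondDiff]

theorem IsPotential.integrable_softThreshold {V W : Euc N → ℝ} (h : IsPotential μ V W) {k : ℝ}
    (hk : 0 < k) : Integrable fun x => softThreshold k (V x) := by
  obtain ⟨B, hB⟩ := h.bounded
  have hs : MeasurableSet {x | k < |V x|} :=
    measurableSet_lt measurable_const h.measurable.abs
  refine Integrable.mono' (g := indicator {x | k < |V x|} fun _ => B)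
    ((integrable_indicator_iff hs).2 (integrableOn_const (h.volume_lt_top k hk).ne))
    ((continuous_softThreshold k).measurable.comp h.measurable).aestronglyMeasurable
    (Eventually.of_forall fun x => ?_)
  by_cases hx : k < |V x|
  · rw [indicator_of_mem (by exact hx)]
    exact (abs_softThreshold_le hk.le _).trans (hB x)
  · rw [indicator_of_notMem (by exact hx), softThreshold_eq_zero (not_lt.1 hx)]
    simp

section Green

variable {V q : Euc N → ℝ}

theorem integrable_sub_mul_sub (hV : Measurable V) {B : ℝ} (hB : ∀ x, |V x| ≤ B)
    (hq : Integrable q) (z : Euc N) :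
    Integrable fun x => (V (x + z) - V x) * (q (x + z) - q x) := by
  refine Integrable.bdd_mul (c := 2 * B) ((hq.comp_add_right z).sub hq)
    (by fun_prop) (Eventually.of_forall fun x => ?_)
  have := abs_sub (V (x + z)) (V x)
  rw [Real.norm_eq_abs]
  linarith [hB (x + z), hB x]

theorem integral_sub_mul_sub (hV : Measurable V) {B : ℝ} (hB : ∀ x, |V x| ≤ B)
    (hq : Integrable q) (z : Euc N) :
    ∫ x, (V (x + z) - V x) * (q (x + z) - q x) = -∫ x, secondDiff V z x * q x := by
  have hb : ∀ a b : Euc N, ‖V a - V b‖ ≤ 2 * B := fun a b => by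
    have := abs_sub (V a) (V b)
    rw [Real.norm_eq_abs]
    linarith [hB a, hB b]
  have h1 : Integrable fun x => (V (x + z) - V x) * q (x + z) :=
    Integrable.bdd_mul (hq.comp_add_right z) (by fun_prop) (Eventually.of_forall fun x => hb _ _)
  have h2 : Integrable fun x => (V (x + z) - V x) * q x :=
    Integrable.bdd_mul hq (by fun_prop) (Eventually.of_forall fun x => hb _ _)
  have h3 : Integrable fun x => (V x - V (x - z)) * q x :=
    Integrable.bdd_mul hq (by fun_prop) (Eventually.of_forall fun x => hb _ _)
  have h4 : ∫ x, (V (x + z) - V x) * q (x + z) = ∫ x, (V x - V (x - z)) * q x := by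
    have := integral_add_right_eq_self (μ := volume) (fun x => (V x - V (x - z)) * q x) z
    simpa using this
  simp only [mul_sub]
  rw [integral_sub h1 h2, h4, ← integral_sub h3 h2, ← integral_neg]
  refine integral_congr_ae (Eventually.of_forall fun x => ?_)
  simp only [secondDiff]; ring

variable {B C : ℝ}

theorem integrable_secondDiff_mul (hμ : IsLevyMeasure μ) (hV : Measurable V)
    (hC : ∀ z x, |secondDiff V z x| ≤ C * min (‖z‖ ^ 2) 1) (hq : Integrable q) :
    Integrable (fun p : Euc N × Euc N => secondDiff V p.1 p.2 * q p.2) (μ.prod volume) := by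
  have := sFinite_of_isLevyMeasure hμ
  refine Integrable.mono' (((integrable_levyWeight hμ).const_mul C).mul_prod hq.abs)
    ((measurable_secondDiff_uncurry hV).aestronglyMeasurable.mul hq.1.comp_snd)
    (Eventually.of_forall fun p => ?_)
  rw [norm_mul]
  exact mul_le_mul_of_nonneg_right (hC _ _) (norm_nonneg _)

theorem integral_symLop_mul (hμ : IsLevyMeasure μ) (hV : Measurable V)
    (hB : ∀ x, |V x| ≤ B) (hC : ∀ z x, |secondDiff V z x| ≤ C * min (‖z‖ ^ 2) 1)
    (hq : Integrable q) :
    ∫ z, (∫ x, (V (x + z) - V x) * (q (x + z) - q x)) ∂μ = -2 * ∫ x, symLop μ V x * q x := by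
  have := sFinite_of_isLevyMeasure hμ
  simp_rw [integral_sub_mul_sub hV hB hq]
  rw [integral_neg, integral_integral_swap (integrable_secondDiff_mul hμ hV hC hq)]
  simp_rw [integral_mul_const, symLop, mul_assoc]
  rw [integral_const_mul]
  ring

theorem integrable_integral_sub_mul_sub (hμ : IsLevyMeasure μ) (hV : Measurable V)
    (hB : ∀ x, |V x| ≤ B) (hC : ∀ z x, |secondDiff V z x| ≤ C * min (‖z‖ ^ 2) 1)
    (hq : Integrable q) :
    Integrable (fun z => ∫ x, (V (x + z) - V x) * (q (x + z) - q x)) μ := by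
  simp_rw [integral_sub_mul_sub hV hB hq]
  exact (integrable_secondDiff_mul hμ hV hC hq).integral_prod_left.neg

end Green

/-- The Dirichlet energy of `V` associated with `μ`. -/
noncomputable def energy (μ : Measure (Euc N)) (V : Euc N → ℝ) : ℝ≥0∞ :=
  ∫⁻ z, (∫⁻ x, ENNReal.ofReal ((V (x + z) - V x) ^ 2 / 2)) ∂μ

theorem tendsto_integral_mul_softThreshold {V W : Euc N → ℝ} (hW : Integrable W)
    (hV : Measurable V) {B : ℝ} (hB : ∀ x, |V x| ≤ B) :
    Tendsto (fun n : ℕ => ∫ x, W x * softThreshold (1 / ((n : ℝ) + 1)) (V x)) atTop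
      (𝓝 (∫ x, W x * V x)) := by
  refine tendsto_integral_of_dominated_convergence (fun x => |W x| * B) (fun n => ?_)
    (hW.abs.mul_const B) (fun n => Eventually.of_forall fun x => ?_)
    (Eventually.of_forall fun x => ?_)
  · exact hW.1.mul ((continuous_softThreshold _).measurable.comp hV).aestronglyMeasurable
  · rw [norm_mul]
    exact mul_le_mul_of_nonneg_left
      ((abs_softThreshold_le (by positivity) _).trans (hB x)) (norm_nonneg _)
  · refine Tendsto.const_mul _ ?_
    rw [tendsto_iff_norm_sub_tendsto_zero]
    exact squeeze_zero (fun n => norm_nonneg _)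
      (fun n => abs_softThreshold_sub_le (by positivity) _)
      tendsto_one_div_add_atTop_nhds_zero_nat

theorem IsPotential.integral_mul_eq {V W q : Euc N → ℝ} (h : IsPotential μ V W)
    (hμ : IsLevyMeasure μ) (hq : Integrable q) :
    ∫ z, (∫ x, (V (x + z) - V x) * (q (x + z) - q x)) ∂μ = -2 * ∫ x, W x * q x := by
  obtain ⟨B, hB⟩ := h.bounded
  obtain ⟨C, hC⟩ := h.secondDiff_le
  rw [integral_symLop_mul hμ h.measurable hB hC hq]
  congr 1
  refine integral_congr_ae ?_
  filter_upwards [h.ae_eq] with x hx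
  rw [hx]

theorem IsPotential.energy_softThreshold_le {V W : Euc N → ℝ} (h : IsPotential μ V W)
    (hμ : IsLevyMeasure μ) {k : ℝ} (hk : 0 < k) :
    0 ≤ -∫ x, W x * softThreshold k (V x) ∧
    energy μ (fun x => softThreshold k (V x)) ≤
      ENNReal.ofReal (-∫ x, W x * softThreshold k (V x)) := by
  obtain ⟨B, hB⟩ := h.bounded
  obtain ⟨C, hC⟩ := h.secondDiff_le
  have hq := h.integrable_softThreshold hk
  have heq := h.integral_mul_eq hμ hq
  have hpos : ∀ z x, 0 ≤ (V (x + z) - V x) *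
      (softThreshold k (V (x + z)) - softThreshold k (V x)) := fun z x =>
    (sq_nonneg _).trans (sq_softThreshold_sub_le_mul k _ _)
  have hpos' : ∀ z, 0 ≤ ∫ x, (V (x + z) - V x) *
      (softThreshold k (V (x + z)) - softThreshold k (V x)) := fun z =>
    integral_nonneg (hpos z)
  have h0 : 0 ≤ -∫ x, W x * softThreshold k (V x) := by
    have : 0 ≤ -2 * ∫ x, W x * softThreshold k (V x) := by
      rw [← heq]
      exact integral_nonneg fun z => hpos' z
    linarith
  refine ⟨h0, ?_⟩
  have h1 : -∫ x, W x * softThreshold k (V x) = ∫ z, (∫ x, (V (x + z) - V x) *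
      (softThreshold k (V (x + z)) - softThreshold k (V x))) / 2 ∂μ := by
    rw [integral_div, heq]; ring
  rw [h1, ofReal_integral_eq_lintegral_ofReal
    ((integrable_integral_sub_mul_sub hμ h.measurable hB hC hq).div_const 2)
    (Eventually.of_forall fun z => div_nonneg (hpos' z) zero_le_two)]
  refine lintegral_mono fun z => ?_
  rw [← integral_div, ofReal_integral_eq_lintegral_ofReal
    ((integrable_sub_mul_sub h.measurable hB hq z).div_const 2)
    (Eventually.of_forall fun x => div_nonneg (hpos z x) zero_le_two)]
  refine lintegral_mono fun x => ENNReal.ofReal_le_ofReal ?_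
  have := sq_softThreshold_sub_le_mul k (V x) (V (x + z))
  linarith

theorem IsPotential.energy_le {V W : Euc N → ℝ} (h : IsPotential μ V W) (hμ : IsLevyMeasure μ) :
    0 ≤ -∫ x, W x * V x ∧ energy μ V ≤ ENNReal.ofReal (-∫ x, W x * V x) := by
  have := sFinite_of_isLevyMeasure hμ
  obtain ⟨B, hB⟩ := h.bounded
  have hV := h.measurable
  have hlim := (tendsto_integral_mul_softThreshold h.integrable h.measurable hB).neg
  have hk : ∀ n : ℕ, 0 < 1 / ((n : ℝ) + 1) := fun n => by positivity
  refine ⟨ge_of_tendsto' hlim fun n => (h.energy_softThreshold_le hμ (hk n)).1, ?_⟩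
  set F : ℕ → Euc N × Euc N → ℝ≥0∞ := fun n p =>
    ENNReal.ofReal ((softThreshold (1 / ((n : ℝ) + 1)) (V (p.2 + p.1))
      - softThreshold (1 / ((n : ℝ) + 1)) (V p.2)) ^ 2 / 2)
  have hFm : ∀ n, Measurable (F n) := fun n => by
    have := (continuous_softThreshold (1 / ((n : ℝ) + 1))).measurable
    fun_prop
  have hF : ∀ n, ∫⁻ p, F n p ∂(μ.prod volume)
      = energy μ (fun x => softThreshold (1 / ((n : ℝ) + 1)) (V x)) := fun n =>
    lintegral_prod _ (hFm n).aemeasurable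
  have hlimF : ∀ p : Euc N × Euc N, Tendsto (fun n => F n p) atTop
      (𝓝 (ENNReal.ofReal ((V (p.2 + p.1) - V p.2) ^ 2 / 2))) := fun p => by
    have hs : ∀ a : ℝ, Tendsto (fun n : ℕ => softThreshold (1 / ((n : ℝ) + 1)) a) atTop (𝓝 a) := by
      intro a
      rw [tendsto_iff_norm_sub_tendsto_zero]
      exact squeeze_zero (fun n => norm_nonneg _)
        (fun n => abs_softThreshold_sub_le (by positivity) _)
        tendsto_one_div_add_atTop_nhds_zero_nat
    exact (ENNReal.continuous_ofReal.tendsto _).comp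
      ((((hs _).sub (hs _)).pow 2).div_const 2)
  calc energy μ V = ∫⁻ p : Euc N × Euc N, ENNReal.ofReal ((V (p.2 + p.1) - V p.2) ^ 2 / 2)
        ∂(μ.prod volume) := (lintegral_prod (f := fun p : Euc N × Euc N =>
          ENNReal.ofReal ((V (p.2 + p.1) - V p.2) ^ 2 / 2))
          (by fun_prop)).symm
    _ = ∫⁻ p, liminf (fun n => F n p) atTop ∂(μ.prod volume) :=
        lintegral_congr fun p => (hlimF p).liminf_eq.symm
    _ ≤ liminf (fun n => ∫⁻ p, F n p ∂(μ.prod volume)) atTop := lintegral_liminf_le hFm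
    _ ≤ liminf (fun n : ℕ => ENNReal.ofReal
          (-∫ x, W x * softThreshold (1 / ((n : ℝ) + 1)) (V x))) atTop := by
        refine liminf_le_liminf (Eventually.of_forall fun n => ?_)
        rw [hF n]
        exact (h.energy_softThreshold_le hμ (hk n)).2
    _ = _ := ((ENNReal.continuous_ofReal.tendsto _).comp hlim).liminf_eq

/-- Cauchy–Schwarz-type inequality for the Dirichlet form, expressed without the form. -/
theorem IsPotential.neg_integral_mul_le {V₁ W₁ V₂ W₂ : Euc N → ℝ} (h₁ : IsPotential μ V₁ W₁)
    (h₂ : IsPotential μ V₂ W₂) (hμ : IsLevyMeasure μ) :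
    -2 * ∫ x, W₁ x * V₂ x ≤ (-∫ x, W₁ x * V₁ x) + (-∫ x, W₂ x * V₂ x) := by
  obtain ⟨B₁, hB₁⟩ := h₁.bounded
  obtain ⟨C₁, hC₁⟩ := h₁.secondDiff_le
  obtain ⟨B₂, hB₂⟩ := h₂.bounded
  have hV₁ := h₁.measurable
  have hV₂ := h₂.measurable
  have := sFinite_of_isLevyMeasure hμ
  obtain ⟨e₁p, e₁⟩ := h₁.energy_le hμ
  obtain ⟨e₂p, e₂⟩ := h₂.energy_le hμ
  refine le_of_tendsto' ((tendsto_integral_mul_softThreshold h₁.integrable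
    h₂.measurable hB₂).const_mul (-2)) fun n => ?_
  have hk : 0 < 1 / ((n : ℝ) + 1) := by positivity
  set k := 1 / ((n : ℝ) + 1)
  have hq := h₂.integrable_softThreshold hk
  rw [← h₁.integral_mul_eq hμ hq]
  rw [← ENNReal.ofReal_le_ofReal_iff (add_nonneg e₁p e₂p), ENNReal.ofReal_add e₁p e₂p]
  refine le_trans ?_ (add_le_add e₁ e₂)
  have hm : ∀ V : Euc N → ℝ, Measurable V → Measurable fun p : Euc N × Euc N =>
      ENNReal.ofReal ((V (p.2 + p.1) - V p.2) ^ 2 / 2) := fun V hV => by fun_prop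
  rw [energy, energy, ← lintegral_add_left (hm V₁ hV₁).lintegral_prod_right']
  refine (ofReal_integral_le_lintegral_ofReal
    (integrable_integral_sub_mul_sub hμ hV₁ hB₁ hC₁ hq)).trans (lintegral_mono fun z => ?_)
  rw [← lintegral_add_left (by fun_prop)]
  refine (ofReal_integral_le_lintegral_ofReal
    (integrable_sub_mul_sub hV₁ hB₁ hq z)).trans (lintegral_mono fun x => ?_)
  rw [← ENNReal.ofReal_add (by positivity) (by positivity)]
  refine ENNReal.ofReal_le_ofReal ?_
  have h1 := sq_softThreshold_sub_le_sq k (V₂ x) (V₂ (x + z))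
  have h2 := two_mul_le_add_sq (V₁ (x + z) - V₁ x)
    (softThreshold k (V₂ (x + z)) - softThreshold k (V₂ x))
  linarith

/-- A smooth function compactly supported in `(0,T)` agrees on `(0,T)` with the derivative of a
test function supported in `(-∞,T)`. -/
theorem exists_primitive_testFn {T : ℝ} {η : ℝ → ℝ}
    (hη : ContDiff ℝ (⊤ : ℕ∞) η) (hηc : HasCompactSupport η) (hηs : tsupport η ⊆ Ioo 0 T) :
    ∃ θ : ℝ → ℝ, ContDiff ℝ (⊤ : ℕ∞) θ ∧ HasCompactSupport θ ∧ tsupport θ ⊆ Iio T ∧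
      ∀ t, 0 < t → deriv θ t = η t := by
  rcases (tsupport η).eq_empty_or_nonempty with hemp | hne
  · refine ⟨0, contDiff_const, HasCompactSupport.zero, by simp [tsupport], fun t _ => ?_⟩
    have := image_eq_zero_of_notMem_tsupport (f := η) (x := t) (by simp [hemp])
    simp [this]
  set b := sSup (tsupport η)
  have hbm : b ∈ tsupport η := hηc.isCompact.sSup_mem hne
  have hb := hηs hbm
  have hηb : ∀ t, b < t → η t = 0 := fun t ht => image_eq_zero_of_notMem_tsupport fun h =>
    not_le.2 ht (le_csSup hηc.isCompact.bddAbove h)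
  have hη0 : ∀ t, t ≤ 0 → η t = 0 := fun t ht => image_eq_zero_of_notMem_tsupport fun h =>
    not_le.2 (hηs h).1 ht
  let χ : ContDiffBump (-2 : ℝ) := ⟨1 / 2, 1, by norm_num, by norm_num⟩
  have hχ : ∀ t, 1 ≤ |t + 2| → χ.normed volume t = 0 := fun t ht => by
    have : t ∉ Function.support (χ.normed volume) := by
      rw [χ.support_normed_eq, Metric.mem_ball, Real.dist_eq]
      have : χ.rOut = 1 := rfl
      rwa [this, not_lt, sub_neg_eq_add]
    simpa using this
  have hχs : ContDiff ℝ (⊤ : ℕ∞) (χ.normed volume) := χ.contDiff_normed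
  set c := ∫ t, η t
  set ζ : ℝ → ℝ := fun t => η t - c * χ.normed volume t
  have hζs : ContDiff ℝ (⊤ : ℕ∞) ζ := hη.sub (contDiff_const.mul hχs)
  have hζc : Continuous ζ := hζs.continuous
  have hηi : Integrable η := hη.continuous.integrable_of_hasCompactSupport hηc
  have hζi : Integrable ζ := hηi.sub (χ.integrable_normed.const_mul c)
  have hζ0 : ∫ t, ζ t = 0 := by
    rw [integral_sub hηi (χ.integrable_normed.const_mul c), integral_const_mul, χ.integral_normed]
    simp [c]
  have hζz : ∀ t, (t ≤ -3 ∨ b < t) → ζ t = 0 := by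
    rintro t (ht | ht)
    · have : 1 ≤ |t + 2| := by rw [abs_of_nonpos] <;> linarith
      simp [ζ, hη0 t (by linarith), hχ t this]
    · have : 1 ≤ |t + 2| := by rw [abs_of_nonneg] <;> linarith [hb.1]
      simp [ζ, hηb t ht, hχ t this]
  set θ : ℝ → ℝ := fun t => ∫ s in (-3 : ℝ)..t, ζ s
  have hθd : ∀ t, HasDerivAt θ (ζ t) t := fun t =>
    intervalIntegral.integral_hasDerivAt_right (hζc.intervalIntegrable _ _)
      (hζc.stronglyMeasurableAtFilter _ _) hζc.continuousAt
  have hθ' : deriv θ = ζ := funext fun t => (hθd t).deriv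
  have hθz : ∀ t, t ∉ Icc (-3) b → θ t = 0 := by
    intro t ht
    rw [mem_Icc, not_and_or, not_le, not_le] at ht
    rcases ht with ht | ht
    · have : ∫ s in (-3 : ℝ)..t, ζ s = ∫ s in (-3 : ℝ)..t, (0 : ℝ) := by
        refine intervalIntegral.integral_congr fun s hs => hζz s (Or.inl ?_)
        rw [uIcc_of_ge ht.le] at hs
        exact hs.2
      simpa [θ] using this
    · have h3 : (-3 : ℝ) ≤ t := by linarith [hb.1]
      change ∫ s in (-3 : ℝ)..t, ζ s = 0
      rw [intervalIntegral.integral_of_le h3, setIntegral_eq_integral_of_forall_compl_eq_zero, hζ0]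
      intro s hs
      rw [mem_Ioc, not_and_or, not_lt, not_le] at hs
      exact hζz s (hs.imp id fun h => ht.trans h)
  have hsub : tsupport θ ⊆ Icc (-3) b := by
    refine closure_minimal (fun t ht => ?_) isClosed_Icc
    by_contra h
    exact ht (hθz t h)
  refine ⟨θ, ?_, isCompact_Icc.of_isClosed_subset (isClosed_tsupport _) hsub,
    fun t ht => (hsub ht).2.trans_lt hb.2, fun t ht => ?_⟩
  · rw [contDiff_infty_iff_deriv]
    exact ⟨fun t => (hθd t).differentiableAt, hθ' ▸ hζs⟩
  · have : 1 ≤ |t + 2| := by rw [abs_of_nonneg] <;> linarith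
    rw [hθ']
    simp [ζ, hχ t this]

/-- If `g` has weak derivative `f` on `[0,T)` with `g(0) = 0`, then `g` is the primitive of `f`. -/
theorem ae_eq_primitive_of_weak {T B : ℝ} (hT : 0 < T) {f g : ℝ → ℝ} (hf : Measurable f)
    (hg : Measurable g) (hfB : ∀ t, |f t| ≤ B) (hgB : ∀ t, |g t| ≤ B)
    (h : ∀ θ : ℝ → ℝ, ContDiff ℝ (⊤ : ℕ∞) θ → HasCompactSupport θ → tsupport θ ⊆ Iio T →
      ∫ t in Ioo 0 T, (deriv θ t * g t + θ t * f t) = 0) :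
    ∀ᵐ t, t ∈ Ioo 0 T → g t = ∫ s in (0 : ℝ)..t, f s := by
  have loc : ∀ f : ℝ → ℝ, Measurable f → (∀ t, |f t| ≤ B) → LocallyIntegrable f := fun f hf hB =>
    (locallyIntegrable_const B).mono hf.aestronglyMeasurable
      (Eventually.of_forall fun t => (hB t).trans (le_abs_self B))
  have hfi : ∀ a b, IntervalIntegrable f volume a b := fun a b =>
    intervalIntegrable_iff.mpr <|
      ((loc f hf hfB).integrableOn_isCompact isCompact_uIcc).mono_set uIoc_subset_uIcc
  have hgi : ∀ a b, IntervalIntegrable g volume a b := fun a b =>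
    intervalIntegrable_iff.mpr <|
      ((loc g hg hgB).integrableOn_isCompact isCompact_uIcc).mono_set uIoc_subset_uIcc
  set F : ℝ → ℝ := fun t => ∫ s in (0 : ℝ)..t, f s
  have hFc : Continuous F := intervalIntegral.continuous_primitive hfi 0
  have key : ∀ᵐ t, t ∈ Ioo 0 T → g t - F t = 0 := by
    refine IsOpen.ae_eq_zero_of_integral_contDiff_smul_eq_zero isOpen_Ioo
      (((loc g hg hgB).sub hFc.locallyIntegrable).locallyIntegrableOn _) fun η hη hηc hηs => ?_
    obtain ⟨θ, hθ, hθc, hθs, hθd⟩ := exists_primitive_testFn hη hηc hηs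
    have h1 := h θ hθ hθc hθs
    have hθ1 : ContDiff ℝ 1 θ := hθ.of_le (by exact_mod_cast le_top)
    have hd : Continuous (deriv θ) := hθ1.continuous_deriv le_rfl
    rw [← integral_Ioc_eq_integral_Ioo, ← intervalIntegral.integral_of_le hT.le,
      intervalIntegral.integral_add ((hgi _ _).continuousOn_mul hd.continuousOn)
        ((hfi _ _).continuousOn_mul hθ.continuous.continuousOn)] at h1
    have hθAC : AbsolutelyContinuousOnInterval θ 0 T :=
      hθ1.contDiffOn.absolutelyContinuousOnInterval
    have hFAC : AbsolutelyContinuousOnInterval F 0 T :=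
      (hfi 0 T).absolutelyContinuousOnInterval_intervalIntegral left_mem_uIcc
    have h2 := hθAC.integral_mul_deriv_eq_deriv_mul hFAC
    have hθT : θ T = 0 := image_eq_zero_of_notMem_tsupport fun h => lt_irrefl T (hθs h)
    have hF0 : F 0 = 0 := by simp [F]
    have hFd : ∫ t in (0 : ℝ)..T, θ t * deriv F t = ∫ t in (0 : ℝ)..T, θ t * f t := by
      refine intervalIntegral.integral_congr_ae ?_
      filter_upwards [_root_.LocallyIntegrable.ae_hasDerivAt_integral (loc f hf hfB)] with t ht _
      rw [(ht 0).deriv]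
    rw [hFd, hθT, hF0] at h2
    rw [h2, zero_mul, mul_zero, sub_zero, zero_sub, ← sub_eq_add_neg,
      ← intervalIntegral.integral_sub ((hgi _ _).continuousOn_mul hd.continuousOn)
        ((hFc.intervalIntegrable _ _).continuousOn_mul hd.continuousOn),
      intervalIntegral.integral_of_le hT.le, integral_Ioc_eq_integral_Ioo] at h1
    rw [← setIntegral_eq_integral_of_forall_compl_eq_zero (s := Ioo 0 T)]
    · refine Eq.trans ?_ h1
      refine setIntegral_congr_fun measurableSet_Ioo fun t ht => ?_
      simp only [hθd t ht.1, smul_eq_mul]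
      ring
    · intro t ht
      rw [image_eq_zero_of_notMem_tsupport fun h => ht (hηs h), zero_smul]
  filter_upwards [key] with t ht hT
  linarith [ht hT]

/-- Convolution of `f` with the kernel `g`. -/
noncomputable def mollify (f g : Euc N → ℝ) (x : Euc N) : ℝ := ∫ y, f y * g (x - y)

section Mollify

variable {f g ρ : Euc N → ℝ} {M : ℝ}

theorem integrable_mollify (hf : Integrable f) (hg : Integrable g) :
    Integrable (mollify f g) :=
  hf.integrable_convolution (ContinuousLinearMap.mul ℝ ℝ) hg

theorem integral_mollify (hf : Integrable f) (hg : Integrable g) :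
    ∫ x, mollify f g x = (∫ x, f x) * ∫ x, g x :=
  integral_convolution (ContinuousLinearMap.mul ℝ ℝ) hf hg

theorem abs_mollify_le (x : Euc N) :
    |mollify f g x| ≤ mollify (fun y => |f y|) (fun y => |g y|) x := by
  unfold mollify
  simp_rw [← abs_mul]
  exact abs_integral_le_integral_abs

theorem integral_abs_mollify_le (hf : Integrable f) (hg : Integrable g) :
    ∫ x, |mollify f g x| ≤ (∫ x, |f x|) * ∫ x, |g x| := by
  rw [← integral_mollify hf.abs hg.abs]
  exact integral_mono (integrable_mollify hf hg).abs (integrable_mollify hf.abs hg.abs)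
    fun x => abs_mollify_le x

theorem integrable_mul_sub_left (hf : Measurable f) (hM : ∀ y, |f y| ≤ M) (hg : Integrable g)
    (x : Euc N) : Integrable fun y => f y * g (x - y) :=
  Integrable.bdd_mul (hg.comp_sub_left x) hf.aestronglyMeasurable (Eventually.of_forall hM)

theorem abs_mollify_le_of_bound (hM : ∀ y, |f y| ≤ M) (hg : Integrable g)
    (x : Euc N) : |mollify f g x| ≤ M * ∫ y, |g y| := by
  rw [← integral_sub_left_eq_self (fun y => |g y|) volume x, ← integral_const_mul]
  refine norm_integral_le_of_norm_le (f := fun y => f y * g (x - y))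
    ((hg.comp_sub_left x).abs.const_mul M) (Eventually.of_forall fun y => ?_)
  rw [norm_mul]
  exact mul_le_mul_of_nonneg_right (hM y) (norm_nonneg _)

theorem secondDiff_mollify (hf : Measurable f) (hM : ∀ y, |f y| ≤ M) (hg : Integrable g)
    (z x : Euc N) : secondDiff (mollify f g) z x = mollify f (secondDiff g z) x := by
  have h := integrable_mul_sub_left hf hM hg
  have h2 : Integrable fun y => f y * g (x + z - y) + f y * g (x - z - y) :=
    (h (x + z)).add (h (x - z))
  simp only [secondDiff, mollify]
  rw [← integral_const_mul, ← integral_add (h _) (h _), ← integral_sub h2 ((h x).const_mul 2)]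
  refine integral_congr_ae (Eventually.of_forall fun y => ?_)
  simp only [add_sub_right_comm x z y, sub_right_comm x z y]
  ring

theorem exists_secondDiff_mollify_le (hf : Measurable f) (hM : ∀ y, |f y| ≤ M)
    (hρ : IsTestFn ρ) :
    ∃ C, ∀ z x, |secondDiff (mollify f ρ) z x| ≤ C * min (‖z‖ ^ 2) 1 := by
  obtain ⟨C, hC0, hC⟩ := exists_integral_secondDiff_bound hρ
  have hM0 : 0 ≤ M := (abs_nonneg _).trans (hM 0)
  refine ⟨M * C, fun z x => ?_⟩
  rw [secondDiff_mollify hf hM (integrable_testFn hρ), mul_assoc]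
  exact (abs_mollify_le_of_bound hM (integrable_secondDiff (integrable_testFn hρ) z) x).trans
    (mul_le_mul_of_nonneg_left (hC z) hM0)

theorem symLop_mollify (hμ : IsLevyMeasure μ) (hf : Measurable f) (hM : ∀ y, |f y| ≤ M)
    (hρ : IsTestFn ρ) (x : Euc N) :
    symLop μ (mollify f ρ) x = mollify f (symLop μ ρ) x := by
  have := sFinite_of_isLevyMeasure hμ
  have hmp : MeasurePreserving (fun p : Euc N × Euc N => (p.1, x - p.2))
      (μ.prod volume) (μ.prod volume) :=
    (MeasurePreserving.id μ).prod (Measure.measurePreserving_sub_left volume x)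
  have hint : Integrable (fun p : Euc N × Euc N => f p.2 * secondDiff ρ p.1 (x - p.2))
      (μ.prod volume) :=
    Integrable.bdd_mul (hmp.integrable_comp_of_integrable (integrable_secondDiff_uncurry hμ hρ))
      (hf.comp measurable_snd).aestronglyMeasurable (Eventually.of_forall fun p => hM p.2)
  unfold symLop
  simp_rw [secondDiff_mollify hf hM (integrable_testFn hρ), mollify]
  rw [integral_integral_swap hint]
  simp_rw [integral_const_mul]
  rw [← integral_const_mul]
  refine integral_congr_ae (Eventually.of_forall fun y => ?_)
  ring

theorem symLop_comp_sub_left (x y : Euc N) :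
    symLop μ (fun y => ρ (x - y)) y = symLop μ ρ (x - y) := by
  unfold symLop
  congr 1
  refine integral_congr_ae (Eventually.of_forall fun z => ?_)
  simp only [secondDiff]
  rw [← sub_sub, sub_sub_eq_add_sub, add_sub_right_comm x z y]
  ring

theorem isTestFn_comp_sub_left (hρ : IsTestFn ρ) (x : Euc N) : IsTestFn fun y => ρ (x - y) :=
  ⟨hρ.1.comp (contDiff_const.sub contDiff_id),
    hρ.2.comp_homeomorph (Homeomorph.subLeft x)⟩

theorem measurable_mollify_time {w : Euc N → ℝ → ℝ}
    (hw : Measurable fun p : Euc N × ℝ => w p.1 p.2) (hg : Measurable g) :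
    Measurable fun p : Euc N × ℝ => mollify (fun y => w y p.2) g p.1 := by
  have : Measurable fun q : (Euc N × ℝ) × Euc N => w q.2 q.1.2 * g (q.1.1 - q.2) := by
    have h1 : Measurable fun q : (Euc N × ℝ) × Euc N => w q.2 q.1.2 :=
      hw.comp (measurable_snd.prodMk (measurable_snd.comp measurable_fst))
    fun_prop
  exact this.stronglyMeasurable.integral_prod_right'.measurable

end Mollify

/-- The difference `w` of two bounded solutions and the difference `Z` of their images under `φ`,
extended by zero outside `(0,T)`. -/
structure IsSolutionGap (μ : Measure (Euc N)) (T M : ℝ) (w Z : Euc N → ℝ → ℝ) : Prop where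
  measurable_w : Measurable fun p : Euc N × ℝ => w p.1 p.2
  measurable_Z : Measurable fun p : Euc N × ℝ => Z p.1 p.2
  abs_w_le : ∀ x t, |w x t| ≤ M
  abs_Z_le : ∀ x t, |Z x t| ≤ M
  w_eq_zero : ∀ x t, t ∉ Ioo 0 T → w x t = 0
  Z_eq_zero : ∀ x t, t ∉ Ioo 0 T → Z x t = 0
  integrable_w : Integrable (fun p : Euc N × ℝ => w p.1 p.2) (volume.prod volume)
  abs_Z_le_add : ∀ δ > 0, ∃ C, 0 ≤ C ∧ ∀ x t, |Z x t| ≤ δ + C * |w x t|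
  weak : ∀ (η : Euc N → ℝ) (θ : ℝ → ℝ), IsTestFn η → ContDiff ℝ (⊤ : ℕ∞) θ →
    HasCompactSupport θ → tsupport θ ⊆ Iio T →
      ∫ t in Ioo 0 T, (deriv θ t * (∫ y, w y t * η y) + θ t * ∫ y, Z y t * Lop μ η y) = 0

/-- The time primitive of `Z`. -/
noncomputable def primitive (Z : Euc N → ℝ → ℝ) (t : ℝ) (y : Euc N) : ℝ := ∫ s in (0 : ℝ)..t, Z y s

namespace IsSolutionGap

variable {T M : ℝ} {w Z : Euc N → ℝ → ℝ} {ρ g : Euc N → ℝ}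

theorem M_nonneg (h : IsSolutionGap μ T M w Z) : 0 ≤ M := (abs_nonneg _).trans (h.abs_w_le 0 0)

theorem measurable_Z_right (h : IsSolutionGap μ T M w Z) (x : Euc N) : Measurable (Z x) :=
  h.measurable_Z.comp measurable_prodMk_left

theorem intervalIntegrable_Z (h : IsSolutionGap μ T M w Z) (x : Euc N) (a b : ℝ) :
    IntervalIntegrable (Z x) volume a b :=
  (intervalIntegrable_const (c := M)).mono_fun (h.measurable_Z_right x).aestronglyMeasurable
    (Eventually.of_forall fun s => (h.abs_Z_le x s).trans (le_abs_self M))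

theorem measurable_primitive_uncurry (h : IsSolutionGap μ T M w Z) :
    Measurable fun p : Euc N × ℝ => primitive Z p.2 p.1 := by
  have hset : Measurable fun q : (Euc N × ℝ) × ℝ => Z q.1.1 q.2 :=
    h.measurable_Z.comp ((measurable_fst.comp measurable_fst).prodMk measurable_snd)
  have key : (fun p : Euc N × ℝ => primitive Z p.2 p.1) =
      fun p => ∫ s, indicator {q : (Euc N × ℝ) × ℝ | q.2 ≤ q.1.2}
        (fun q => Z q.1.1 q.2) (p, s) := by
    funext ⟨x, t⟩
    have hz : ∀ s, s ≤ 0 → Z x s = 0 := fun s hs => h.Z_eq_zero x s fun hs' => not_lt.2 hs hs'.1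
    have h1 : ∀ s, indicator {q : (Euc N × ℝ) × ℝ | q.2 ≤ q.1.2}
        (fun q => Z q.1.1 q.2) ((x, t), s) = indicator (Iic t) (Z x) s := fun s => by
      simp [indicator]
    simp_rw [h1]
    rw [integral_indicator measurableSet_Iic]
    change ∫ s in (0 : ℝ)..t, Z x s = _
    rcases le_total 0 t with ht | ht
    · rw [intervalIntegral.integral_of_le ht]
      refine (setIntegral_eq_of_subset_of_forall_sdiff_eq_zero measurableSet_Iic
        Ioc_subset_Iic_self fun s hs => hz s ?_).symm
      by_contra h0
      exact hs.2 ⟨not_le.1 h0, hs.1⟩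
    · have h0 : ∫ s in Iic t, Z x s = 0 :=
        setIntegral_eq_zero_of_forall_eq_zero fun s hs => hz s (le_trans hs ht)
      rw [h0, intervalIntegral.integral_of_ge ht,
        setIntegral_eq_zero_of_forall_eq_zero fun s hs => hz s hs.2, neg_zero]
  rw [key]
  refine StronglyMeasurable.measurable (StronglyMeasurable.integral_prod_right'
    (f := indicator {q : (Euc N × ℝ) × ℝ | q.2 ≤ q.1.2} (fun q => Z q.1.1 q.2)) ?_)
  exact (hset.indicator (measurableSet_le (by fun_prop) (by fun_prop))).stronglyMeasurable

theorem measurable_primitive (h : IsSolutionGap μ T M w Z) (t : ℝ) : Measurable (primitive Z t) :=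
  h.measurable_primitive_uncurry.comp measurable_prodMk_right

theorem primitive_of_nonpos (h : IsSolutionGap μ T M w Z) {t : ℝ} (ht : t ≤ 0) :
    primitive Z t = 0 := by
  funext y
  simp only [primitive, Pi.zero_apply]
  rw [intervalIntegral.integral_of_ge ht, setIntegral_eq_zero_of_forall_eq_zero, neg_zero]
  exact fun s hs => h.Z_eq_zero y s fun hs' => not_lt.2 hs.2 hs'.1

theorem abs_primitive_sub_le (h : IsSolutionGap μ T M w Z) (s t : ℝ) (y : Euc N) :
    |primitive Z t y - primitive Z s y| ≤ M * |t - s| := by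
  rw [primitive, primitive, intervalIntegral.integral_interval_sub_left
    (h.intervalIntegrable_Z y 0 t) (h.intervalIntegrable_Z y 0 s)]
  exact intervalIntegral.norm_integral_le_of_norm_le_const (f := Z y) fun r _ => h.abs_Z_le y r

theorem abs_primitive_le (h : IsSolutionGap μ T M w Z) (t : ℝ) (y : Euc N) :
    |primitive Z t y| ≤ M * |t| := by
  simpa [primitive] using h.abs_primitive_sub_le 0 t y

theorem integral_mollify_time (h : IsSolutionGap μ T M w Z) (hg : Integrable g) (t : ℝ)
    (x : Euc N) :
    ∫ s in (0 : ℝ)..t, mollify (fun y => Z y s) g x = mollify (primitive Z t) g x := by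
  unfold mollify primitive
  simp_rw [← intervalIntegral.integral_mul_const]
  refine intervalIntegral_integral_swap (f := fun s y => Z y s * g (x - y)) ?_
  have h1 : Integrable (fun p : ℝ × Euc N => (1 : ℝ) * g (x - p.2))
      ((volume.restrict (uIoc 0 t)).prod volume) :=
    Integrable.mul_prod (f := fun _ => (1 : ℝ)) (g := fun y => g (x - y))
      (integrableOn_const (by simp [uIoc])) (hg.comp_sub_left x)
  simp only [one_mul] at h1
  exact Integrable.bdd_mul h1 (h.measurable_Z.comp measurable_swap).aestronglyMeasurable
    (Eventually.of_forall fun p => h.abs_Z_le p.2 p.1)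

/-- The mollified equation integrated in time. -/
theorem mollify_ae_eq_symLop (h : IsSolutionGap μ T M w Z) (hμ : IsLevyMeasure μ) (hT : 0 < T)
    (hρ : IsTestFn ρ) (x : Euc N) :
    ∀ᵐ t, t ∈ Ioo 0 T →
      mollify (fun y => w y t) ρ x = symLop μ (mollify (primitive Z t) ρ) x := by
  have := sFinite_of_isLevyMeasure hμ
  have hρi := integrable_testFn hρ
  have hρm := hρ.1.continuous.measurable
  have hLi := integrable_symLop hμ hρ
  have hLm : Measurable (symLop μ ρ) := measurable_symLop hρm
  have hMn := h.M_nonneg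
  have key := ae_eq_primitive_of_weak (B := max (M * ∫ y, |symLop μ ρ y|) (M * ∫ y, |ρ y|)) hT
    (f := fun t => mollify (fun y => Z y t) (symLop μ ρ) x)
    (g := fun t => mollify (fun y => w y t) ρ x)
    ((measurable_mollify_time h.measurable_Z hLm).comp measurable_prodMk_left)
    ((measurable_mollify_time h.measurable_w hρm).comp measurable_prodMk_left)
    (fun t => (abs_mollify_le_of_bound (fun y => h.abs_Z_le y t) hLi x).trans (le_max_left _ _))
    (fun t => (abs_mollify_le_of_bound (fun y => h.abs_w_le y t) hρi x).trans (le_max_right _ _))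
    (fun θ hθ hθc hθs => by
      have hη := isTestFn_comp_sub_left hρ x
      have := h.weak _ θ hη hθ hθc hθs
      rw [Lop_eq_symLop hμ hη] at this
      simp only [symLop_comp_sub_left] at this
      exact this)
  filter_upwards [key] with t ht htT
  rw [ht htT, h.integral_mollify_time hLi, symLop_mollify hμ (h.measurable_primitive t)
    (h.abs_primitive_le t) hρ]

theorem ae_integrable_w (h : IsSolutionGap μ T M w Z) : ∀ᵐ t, Integrable fun x => w x t :=
  h.integrable_w.prod_left_ae

theorem ae_integrable_w_right (h : IsSolutionGap μ T M w Z) : ∀ᵐ x, Integrable fun t => w x t :=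
  h.integrable_w.prod_right_ae

theorem volume_mollify_primitive_lt_top (h : IsSolutionGap μ T M w Z)
    (hT : 0 < T) (hρ : Integrable ρ) (t : ℝ) (htT : t < T) (k : ℝ) (hk : 0 < k) :
    volume {x | k < |mollify (primitive Z t) ρ x|} < ⊤ := by
  rcases le_total t 0 with ht | ht
  · rw [h.primitive_of_nonpos ht]
    simp [mollify, not_lt.2 hk.le]
  set I := ∫ y, |ρ y|
  have hI : 0 ≤ I := integral_nonneg fun y => abs_nonneg _
  set δ := k / (2 * (T * I + 1))
  have hδ : 0 < δ := by positivity
  obtain ⟨C, hC0, hC⟩ := h.abs_Z_le_add δ hδ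
  set a : Euc N → ℝ := fun y => C * ∫ s, |w y s|
  have ha : Integrable a := h.integrable_w.abs.integral_prod_left.const_mul C
  have ha0 : ∀ y, 0 ≤ a y := fun y => mul_nonneg hC0 (integral_nonneg fun s => abs_nonneg _)
  have hU : ∀ᵐ y, |primitive Z t y| ≤ δ * T + a y := by
    filter_upwards [h.ae_integrable_w_right] with y hy
    have hwi : Integrable (fun s => |w y s|) (volume.restrict (Ioc 0 t)) := hy.abs.integrableOn
    calc |primitive Z t y| ≤ ∫ s in (0 : ℝ)..t, |Z y s| :=
          intervalIntegral.abs_integral_le_integral_abs ht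
      _ = ∫ s in Ioc 0 t, |Z y s| := intervalIntegral.integral_of_le ht
      _ ≤ ∫ s in Ioc 0 t, (δ + C * |w y s|) := by
          refine integral_mono ?_ ((integrable_const δ).add (hwi.const_mul C)) fun s => hC y s
          exact ((h.intervalIntegrable_Z y 0 t).1).abs
      _ = t * δ + C * ∫ s in Ioc 0 t, |w y s| := by
          rw [integral_add (integrable_const δ) (hwi.const_mul C), integral_const_mul]
          simp [ht]
      _ ≤ δ * T + a y := by
          have h1 : ∫ s in Ioc 0 t, |w y s| ≤ ∫ s, |w y s| :=
            setIntegral_le_integral hy.abs (Eventually.of_forall fun s => abs_nonneg _)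
          have h2 := mul_le_mul_of_nonneg_left h1 hC0
          have h3 := mul_le_mul_of_nonneg_left htT.le hδ.le
          simp only [a]; linarith
  have hbound : ∀ x, |mollify (primitive Z t) ρ x| ≤ k / 2 + |mollify a (fun y => |ρ y|) x| ∨
      ¬ Integrable fun y => a y * |ρ (x - y)| := by
    intro x
    refine or_iff_not_imp_right.2 fun hx => ?_
    rw [not_not] at hx
    have h1 : |mollify (primitive Z t) ρ x| ≤ ∫ y, (δ * T * |ρ (x - y)| + a y * |ρ (x - y)|) := by
      refine norm_integral_le_of_norm_le (f := fun y => primitive Z t y * ρ (x - y))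
        (((hρ.comp_sub_left x).abs.const_mul _).add hx) ?_
      filter_upwards [hU] with y hy
      rw [norm_mul, ← add_mul]
      exact mul_le_mul_of_nonneg_right hy (norm_nonneg _)
    rw [integral_add ((hρ.comp_sub_left x).abs.const_mul _) hx, integral_const_mul,
      integral_sub_left_eq_self (fun y => |ρ y|) volume x] at h1
    have h2 : δ * T * I ≤ k / 2 := by
      have : δ * (T * I + 1) = k / 2 := by
        simp only [δ]; field_simp
      nlinarith
    have h3 := le_abs_self (mollify a (fun y => |ρ y|) x)
    change _ ≤ δ * T * I + mollify a (fun y => |ρ y|) x at h1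
    linarith
  have hint := integrable_mollify ha hρ.abs
  refine lt_of_le_of_lt ?_ (hint.abs.measure_gt_lt_top (half_pos hk))
  refine measure_mono_ae ?_
  have hae : ∀ᵐ x, Integrable fun y => a y * |ρ (x - y)| :=
    (ha.convolution_integrand (ContinuousLinearMap.mul ℝ ℝ) hρ.abs).prod_right_ae
  filter_upwards [hae] with x hx hxk
  rcases hbound x with h1 | h1
  · have : k < |mollify (primitive Z t) ρ x| := hxk
    change k / 2 < |mollify a (fun y => |ρ y|) x|
    linarith
  · exact absurd hx h1

theorem ae_isPotential (h : IsSolutionGap μ T M w Z) (hμ : IsLevyMeasure μ) (hT : 0 < T)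
    (hρ : IsTestFn ρ) :
    ∀ᵐ t, t < T → IsPotential μ (mollify (primitive Z t) ρ) (mollify (fun y => w y t) ρ) := by
  have := sFinite_of_isLevyMeasure hμ
  have hρi := integrable_testFn hρ
  have hρm := hρ.1.continuous.measurable
  have hVm : Measurable fun p : Euc N × ℝ => mollify (primitive Z p.2) ρ p.1 :=
    measurable_mollify_time (w := fun y t => primitive Z t y) h.measurable_primitive_uncurry hρm
  have hLm : Measurable fun p : Euc N × ℝ => symLop μ (mollify (primitive Z p.2) ρ) p.1 := by
    have : Measurable fun q : (Euc N × ℝ) × Euc N =>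
        secondDiff (mollify (primitive Z q.1.2) ρ) q.2 q.1.1 := by
      have e : ∀ k : (Euc N × ℝ) × Euc N → Euc N, Measurable k →
          Measurable fun q : (Euc N × ℝ) × Euc N => mollify (primitive Z q.1.2) ρ (k q) :=
        fun k hk => hVm.comp (hk.prodMk (measurable_snd.comp measurable_fst))
      unfold secondDiff
      exact ((e _ (by fun_prop)).add (e _ (by fun_prop))).sub ((e _ (by fun_prop)).const_mul 2)
    exact this.stronglyMeasurable.integral_prod_right'.measurable.const_mul _
  have hset : MeasurableSet {p : Euc N × ℝ | p.2 ∈ Ioo 0 T →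
      mollify (fun y => w y p.2) ρ p.1 = symLop μ (mollify (primitive Z p.2) ρ) p.1} := by
    have h1 := measurableSet_eq_fun (measurable_mollify_time h.measurable_w hρm) hLm
    exact (measurable_snd measurableSet_Ioo).himp h1
  have hae : ∀ᵐ t, ∀ᵐ x, t ∈ Ioo 0 T →
      mollify (fun y => w y t) ρ x = symLop μ (mollify (primitive Z t) ρ) x := by
    have h1 : ∀ᵐ p : Euc N × ℝ ∂(volume.prod volume), p.2 ∈ Ioo 0 T →
        mollify (fun y => w y p.2) ρ p.1 = symLop μ (mollify (primitive Z p.2) ρ) p.1 :=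
      (Measure.ae_prod_iff_ae_ae hset).2
        (Eventually.of_forall fun x => h.mollify_ae_eq_symLop hμ hT hρ x)
    exact Measure.ae_ae_comm hset |>.1 (Measure.ae_ae_of_ae_prod h1)
  filter_upwards [hae, h.ae_integrable_w] with t ht hti htT
  rcases le_or_gt t 0 with ht0 | ht0
  · have e1 : mollify (primitive Z t) ρ = 0 := by
      funext x; simp [h.primitive_of_nonpos ht0, mollify]
    have e2 : mollify (fun y => w y t) ρ = 0 := by
      funext x; simp [h.w_eq_zero _ t fun h' => not_lt.2 ht0 h'.1, mollify]
    rw [e1, e2]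
    exact IsPotential.zero
  · exact {
      measurable := hVm.comp measurable_prodMk_right
      bounded := ⟨_, fun x => abs_mollify_le_of_bound (h.abs_primitive_le t) hρi x⟩
      secondDiff_le := exists_secondDiff_mollify_le (h.measurable_primitive t)
        (h.abs_primitive_le t) hρ
      volume_lt_top := h.volume_mollify_primitive_lt_top hT hρi t htT
      integrable := integrable_mollify hti hρi
      ae_eq := by filter_upwards [ht] with x hx using hx ⟨ht0, htT⟩ }

end IsSolutionGap

section Mollify

variable {f g : Euc N → ℝ}

theorem mollify_sub {f₁ f₂ : Euc N → ℝ} {M₁ M₂ : ℝ} (hf₁ : Measurable f₁) (hM₁ : ∀ y, |f₁ y| ≤ M₁)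
    (hf₂ : Measurable f₂) (hM₂ : ∀ y, |f₂ y| ≤ M₂) (hg : Integrable g) (x : Euc N) :
    mollify f₁ g x - mollify f₂ g x = mollify (fun y => f₁ y - f₂ y) g x := by
  unfold mollify
  rw [← integral_sub (integrable_mul_sub_left hf₁ hM₁ hg x) (integrable_mul_sub_left hf₂ hM₂ hg x)]
  simp_rw [sub_mul]

theorem mollify_eq_zero (hf : f =ᵐ[volume] 0) : mollify f g = 0 := by
  funext x
  refine integral_eq_zero_of_ae ?_
  filter_upwards [hf] with y hy
  simp [hy]

theorem integrable_mollify_time {w : Euc N → ℝ → ℝ}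
    (hw : Measurable fun p : Euc N × ℝ => w p.1 p.2)
    (hwi : Integrable (fun p : Euc N × ℝ => w p.1 p.2) (volume.prod volume))
    (hg : Measurable g) (hgi : Integrable g) :
    Integrable (fun p : Euc N × ℝ => mollify (fun y => w y p.2) g p.1) (volume.prod volume) := by
  have hm := measurable_mollify_time hw hg
  refine (integrable_prod_iff' hm.aestronglyMeasurable).2 ⟨?_, ?_⟩
  · filter_upwards [hwi.prod_left_ae] with t ht using integrable_mollify ht hgi
  · refine (hwi.integral_norm_prod_right.mul_const (∫ y, |g y|)).mono'
      hm.norm.stronglyMeasurable.integral_prod_left'.aestronglyMeasurable ?_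
    filter_upwards [hwi.prod_left_ae] with t ht
    rw [Real.norm_of_nonneg (integral_nonneg fun x => norm_nonneg _)]
    exact integral_abs_mollify_le ht hgi

end Mollify

namespace IsSolutionGap

variable {T M : ℝ} {w Z : Euc N → ℝ → ℝ} {ρ : Euc N → ℝ}

theorem mollify_w_eq_zero (h : IsSolutionGap μ T M w Z) {t : ℝ} (ht : t ∉ Ioo 0 T) :
    mollify (fun y => w y t) ρ = 0 :=
  mollify_eq_zero (Eventually.of_forall fun y => h.w_eq_zero y t ht)

theorem measurable_mollify_primitive (h : IsSolutionGap μ T M w Z) (hρ : Measurable ρ) :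
    Measurable fun p : Euc N × ℝ => mollify (primitive Z p.2) ρ p.1 :=
  measurable_mollify_time (w := fun y t => primitive Z t y) h.measurable_primitive_uncurry hρ

theorem abs_mollify_primitive_sub_le (h : IsSolutionGap μ T M w Z) (hρ : Integrable ρ)
    (s t : ℝ) (x : Euc N) :
    |mollify (primitive Z t) ρ x - mollify (primitive Z s) ρ x| ≤ M * |t - s| * ∫ y, |ρ y| := by
  rw [mollify_sub (h.measurable_primitive t) (h.abs_primitive_le t) (h.measurable_primitive s)
    (h.abs_primitive_le s) hρ]
  exact abs_mollify_le_of_bound (fun y => h.abs_primitive_sub_le s t y) hρ x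

/-- The discrete time derivative of the potential tested against the mollified gap. -/
theorem integral_mul_timeDiff_nonpos (h : IsSolutionGap μ T M w Z) (hμ : IsLevyMeasure μ)
    (hT : 0 < T) (hρ : IsTestFn ρ) {s : ℝ} (hs : 0 ≤ s) :
    ∫ p : Euc N × ℝ, mollify (fun y => w y p.2) ρ p.1 *
      (mollify (primitive Z p.2) ρ p.1 - mollify (primitive Z (p.2 - s)) ρ p.1)
        ∂(volume.prod volume) ≤ 0 := by
  have hρi := integrable_testFn hρ
  have hρm := hρ.1.continuous.measurable
  have hI : 0 ≤ ∫ y, |ρ y| := integral_nonneg fun y => abs_nonneg _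
  have hWi := integrable_mollify_time h.measurable_w h.integrable_w hρm hρi
  have hVm := h.measurable_mollify_primitive hρm
  have hVsm : Measurable fun p : Euc N × ℝ => mollify (primitive Z (p.2 - s)) ρ p.1 :=
    hVm.comp (measurable_fst.prodMk (measurable_snd.sub_const s))
  have hint : Integrable (fun p : Euc N × ℝ => mollify (fun y => w y p.2) ρ p.1 *
      (mollify (primitive Z p.2) ρ p.1 - mollify (primitive Z (p.2 - s)) ρ p.1))
        (volume.prod volume) :=
    hWi.mul_bdd (hVm.sub hVsm).aestronglyMeasurable
      (Eventually.of_forall fun p => h.abs_mollify_primitive_sub_le hρi (p.2 - s) p.2 p.1 |>.trans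
        (le_of_eq (by rw [sub_sub_cancel])))
  have hWVi : Integrable (fun p : Euc N × ℝ => mollify (fun y => w y p.2) ρ p.1 *
      mollify (primitive Z p.2) ρ p.1) (volume.prod volume) := by
    refine (hWi.abs.mul_const (M * T * ∫ y, |ρ y|)).mono'
      (hWi.aestronglyMeasurable.mul hVm.aestronglyMeasurable) (Eventually.of_forall fun p => ?_)
    by_cases ht : p.2 ∈ Ioo 0 T
    · rw [norm_mul]
      refine mul_le_mul_of_nonneg_left ?_ (abs_nonneg _)
      refine (abs_mollify_le_of_bound (h.abs_primitive_le p.2) hρi p.1).trans ?_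
      rw [abs_of_pos ht.1]
      exact mul_le_mul_of_nonneg_right (mul_le_mul_of_nonneg_left ht.2.le h.M_nonneg) hI
    · simp [h.mollify_w_eq_zero ht]
  set k : ℝ → ℝ := fun t => -∫ x, mollify (fun y => w y t) ρ x * mollify (primitive Z t) ρ x
    with hk
  have hki : Integrable k := hWVi.integral_prod_right.neg
  have hpot := h.ae_isPotential hμ hT hρ
  have hpots := (measurePreserving_sub_right volume s).quasiMeasurePreserving.ae hpot
  have hk0 : ∀ t, T ≤ t → k t = 0 := fun t ht => by
    simp [hk, h.mollify_w_eq_zero (ρ := ρ) fun ht' : t ∈ Ioo 0 T => not_lt.2 ht ht'.2]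
  rw [integral_prod_symm _ hint]
  have hle : ∫ t, ∫ x, mollify (fun y => w y t) ρ x *
      (mollify (primitive Z t) ρ x - mollify (primitive Z (t - s)) ρ x) ≤
        ∫ t, (1 / 2) * (k (t - s) - k t) := by
    refine integral_mono_ae hint.integral_prod_right
      (((hki.comp_sub_right s).sub hki).const_mul _) ?_
    filter_upwards [hpot, hpots, hint.prod_left_ae, hWVi.prod_left_ae] with t h1 h2 h3 h4
    rcases lt_or_ge t T with ht | ht
    · have e1 := (h1 ht).neg_integral_mul_le (h2 (by linarith)) hμ
      have e2 : ∫ x, mollify (fun y => w y t) ρ x * mollify (primitive Z (t - s)) ρ x =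
          (∫ x, mollify (fun y => w y t) ρ x * mollify (primitive Z t) ρ x) -
          ∫ x, mollify (fun y => w y t) ρ x *
            (mollify (primitive Z t) ρ x - mollify (primitive Z (t - s)) ρ x) := by
        rw [← integral_sub h4 h3]
        refine integral_congr_ae (Eventually.of_forall fun x => ?_)
        ring
      rw [e2] at e1
      simp only [hk]
      linarith
    · have e1 : ∀ x, mollify (fun y => w y t) ρ x = 0 := fun x => by
        rw [h.mollify_w_eq_zero fun ht' : t ∈ Ioo 0 T => not_lt.2 ht ht'.2]; rfl
      have e2 : 0 ≤ k (t - s) := by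
        rcases lt_or_ge (t - s) T with ht' | ht'
        · exact ((h2 ht').energy_le hμ).1
        · exact (hk0 _ ht').ge
      simp only [e1, zero_mul, integral_zero, hk0 t ht]
      linarith
  refine hle.trans (le_of_eq ?_)
  rw [integral_const_mul, integral_sub (hki.comp_sub_right s) hki, integral_sub_right_eq_self,
    sub_self, mul_zero]

theorem ae_tendsto_timeDiff (h : IsSolutionGap μ T M w Z) (hρm : Measurable ρ)
    (hρ : Integrable ρ) :
    ∀ᵐ p : Euc N × ℝ ∂(volume.prod volume), Tendsto (fun n : ℕ => ((n : ℝ) + 1) *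
      (mollify (primitive Z p.2) ρ p.1 - mollify (primitive Z (p.2 - 1 / ((n : ℝ) + 1))) ρ p.1))
      atTop (𝓝 (mollify (fun y => Z y p.2) ρ p.1)) := by
  have hVm := h.measurable_mollify_primitive hρm
  have hZm := measurable_mollify_time h.measurable_Z hρm
  refine (Measure.ae_prod_iff_ae_ae (measurableSet_tendsto_fun (fun n => ?_) hZm)).2 ?_
  · exact (hVm.sub (hVm.comp (measurable_fst.prodMk (measurable_snd.sub_const _)))).const_mul _
  refine Eventually.of_forall fun x => ?_
  have hloc : LocallyIntegrable fun t => mollify (fun y => Z y t) ρ x :=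
    (locallyIntegrable_const (M * ∫ y, |ρ y|)).mono
      (hZm.comp measurable_prodMk_left).aestronglyMeasurable
      (Eventually.of_forall fun t =>
        (abs_mollify_le_of_bound (fun y => h.abs_Z_le y t) hρ x).trans (le_abs_self _))
  filter_upwards [_root_.LocallyIntegrable.ae_hasDerivAt_integral hloc] with t ht
  have hd := ht 0
  simp_rw [h.integral_mollify_time hρ] at hd
  have hlim : Tendsto (fun n : ℕ => t - 1 / ((n : ℝ) + 1)) atTop (𝓝[≠] t) := by
    refine tendsto_nhdsWithin_iff.2 ⟨?_, Eventually.of_forall fun n => ?_⟩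
    · simpa using (tendsto_const_nhds (x := t)).sub
        (tendsto_one_div_add_atTop_nhds_zero_nat (𝕜 := ℝ))
    · have : 0 < 1 / ((n : ℝ) + 1) := by positivity
      simp only [mem_compl_iff, mem_singleton_iff]
      intro h'
      linarith
  refine (hd.tendsto_slope.comp hlim).congr fun n => ?_
  have : (n : ℝ) + 1 ≠ 0 := by positivity
  simp only [Function.comp_apply, slope_def_field]
  field_simp
  ring

theorem integral_mollify_mul_mollify_nonpos (h : IsSolutionGap μ T M w Z) (hμ : IsLevyMeasure μ)
    (hT : 0 < T) (hρ : IsTestFn ρ) :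
    ∫ p : Euc N × ℝ, mollify (fun y => w y p.2) ρ p.1 * mollify (fun y => Z y p.2) ρ p.1
      ∂(volume.prod volume) ≤ 0 := by
  have hρi := integrable_testFn hρ
  have hρm := hρ.1.continuous.measurable
  have hWi := integrable_mollify_time h.measurable_w h.integrable_w hρm hρi
  have hVm := h.measurable_mollify_primitive hρm
  refine le_of_tendsto' (x := atTop) (f := fun n : ℕ => ∫ p : Euc N × ℝ,
    mollify (fun y => w y p.2) ρ p.1 * (((n : ℝ) + 1) * (mollify (primitive Z p.2) ρ p.1 -
      mollify (primitive Z (p.2 - 1 / ((n : ℝ) + 1))) ρ p.1)) ∂(volume.prod volume)) ?_ fun n => ?_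
  · refine tendsto_integral_of_dominated_convergence
      (fun p => |mollify (fun y => w y p.2) ρ p.1| * (M * ∫ y, |ρ y|)) (fun n => ?_)
      (hWi.abs.mul_const _) (fun n => Eventually.of_forall fun p => ?_) ?_
    · exact hWi.aestronglyMeasurable.mul ((hVm.sub (hVm.comp
        (measurable_fst.prodMk (measurable_snd.sub_const _)))).const_mul _).aestronglyMeasurable
    · have hn : 0 < (n : ℝ) + 1 := by positivity
      rw [norm_mul, norm_mul, Real.norm_of_nonneg hn.le]
      refine mul_le_mul_of_nonneg_left ?_ (abs_nonneg _)
      have := mul_le_mul_of_nonneg_left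
        (h.abs_mollify_primitive_sub_le hρi (p.2 - 1 / ((n : ℝ) + 1)) p.2 p.1) hn.le
      refine this.trans (le_of_eq ?_)
      rw [sub_sub_cancel, abs_of_pos (by positivity)]
      field_simp
    · filter_upwards [h.ae_tendsto_timeDiff hρm hρi] with p hp using hp.const_mul _
  · have hn : 0 < (n : ℝ) + 1 := by positivity
    have := h.integral_mul_timeDiff_nonpos hμ hT hρ (s := 1 / ((n : ℝ) + 1)) (by positivity)
    simp_rw [mul_left_comm _ ((n : ℝ) + 1)]
    rw [integral_const_mul]
    exact mul_nonpos_of_nonneg_of_nonpos hn.le this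

end IsSolutionGap

/-- A sequence of nonnegative smooth kernels approximating the identity. -/
noncomputable def approxKernel (N n : ℕ) : ContDiffBump (0 : Euc N) where
  rIn := 1 / ((n : ℝ) + 1)
  rOut := 2 * (1 / ((n : ℝ) + 1))
  rIn_pos := by positivity
  rIn_lt_rOut := by
    have : 0 < 1 / ((n : ℝ) + 1) := by positivity
    linarith

theorem isTestFn_approxKernel (n : ℕ) : IsTestFn ((approxKernel N n).normed volume) :=
  ⟨(approxKernel N n).contDiff_normed, (approxKernel N n).hasCompactSupport_normed⟩

theorem ae_tendsto_mollify_approxKernel {w : Euc N → ℝ → ℝ} {M : ℝ}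
    (hw : Measurable fun p : Euc N × ℝ => w p.1 p.2) (hM : ∀ x t, |w x t| ≤ M) :
    ∀ᵐ p : Euc N × ℝ ∂(volume.prod volume), Tendsto (fun n : ℕ =>
      mollify (fun y => w y p.2) ((approxKernel N n).normed volume) p.1) atTop (𝓝 (w p.1 p.2)) := by
  have hset : MeasurableSet {p : Euc N × ℝ | Tendsto (fun n : ℕ =>
      mollify (fun y => w y p.2) ((approxKernel N n).normed volume) p.1) atTop (𝓝 (w p.1 p.2))} :=
    measurableSet_tendsto_fun (fun n => measurable_mollify_time hw
      (isTestFn_approxKernel n).1.continuous.measurable) hw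
  refine (Measure.ae_prod_iff_ae_ae hset).2 ((Measure.ae_ae_comm hset).2
    (Eventually.of_forall fun t => ?_))
  have hloc : LocallyIntegrable fun y => w y t :=
    (locallyIntegrable_const M).mono (hw.comp measurable_prodMk_right).aestronglyMeasurable
      (Eventually.of_forall fun y => (hM y t).trans (le_abs_self M))
  have h0 : Tendsto (fun n : ℕ => (approxKernel N n).rOut) atTop (𝓝 0) := by
    simpa [approxKernel] using
      (tendsto_one_div_add_atTop_nhds_zero_nat (𝕜 := ℝ)).const_mul 2
  filter_upwards [ContDiffBump.ae_convolution_tendsto_right_of_locallyIntegrable (K := 2) h0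
    (Eventually.of_forall fun n => le_rfl) hloc] with x hx
  refine hx.congr fun n => ?_
  rw [convolution_lsmul_swap]
  simp only [mollify, smul_eq_mul, mul_comm]

/-- Fatou's lemma for Bochner integrals bounded by a constant. -/
theorem integral_le_of_tendsto_of_nonneg {α : Type*} [MeasurableSpace α] {ν : Measure α}
    {F : ℕ → α → ℝ} {G : α → ℝ} {B : ℝ} (hF : ∀ n, Integrable (F n) ν)
    (hF0 : ∀ n, 0 ≤ᵐ[ν] F n) (hFB : ∀ n, ∫ a, F n a ∂ν ≤ B) (hG : Integrable G ν)
    (hlim : ∀ᵐ a ∂ν, Tendsto (fun n => F n a) atTop (𝓝 (G a))) : ∫ a, G a ∂ν ≤ B := by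
  have hB : 0 ≤ B := (integral_nonneg_of_ae (hF0 0)).trans (hFB 0)
  have hG0 : 0 ≤ᵐ[ν] G := by
    filter_upwards [hlim, ae_all_iff.2 hF0] with a h1 h2
    exact ge_of_tendsto' h1 h2
  rw [← ENNReal.ofReal_le_ofReal_iff hB, ofReal_integral_eq_lintegral_ofReal hG hG0]
  calc ∫⁻ a, ENNReal.ofReal (G a) ∂ν
      = ∫⁻ a, liminf (fun n => ENNReal.ofReal (F n a)) atTop ∂ν := by
        refine lintegral_congr_ae ?_
        filter_upwards [hlim] with a ha
        exact ((ENNReal.tendsto_ofReal ha).liminf_eq).symm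
    _ ≤ liminf (fun n => ∫⁻ a, ENNReal.ofReal (F n a) ∂ν) atTop :=
        lintegral_liminf_le' fun n => (hF n).aestronglyMeasurable.aemeasurable.ennreal_ofReal
    _ ≤ liminf (fun _ : ℕ => ENNReal.ofReal B) atTop := by
        refine liminf_le_liminf (Eventually.of_forall fun n => ?_)
        rw [← ofReal_integral_eq_lintegral_ofReal (hF n) (hF0 n)]
        exact ENNReal.ofReal_le_ofReal (hFB n)
    _ = ENNReal.ofReal B := by simp

namespace IsSolutionGap

variable {T M : ℝ} {w Z : Euc N → ℝ → ℝ}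

theorem integral_mul_nonpos (h : IsSolutionGap μ T M w Z) (hμ : IsLevyMeasure μ) (hT : 0 < T) :
    ∫ p : Euc N × ℝ, w p.1 p.2 * Z p.1 p.2 ∂(volume.prod volume) ≤ 0 := by
  have hMn := h.M_nonneg
  have habs : Measurable fun p : Euc N × ℝ => |w p.1 p.2| := h.measurable_w.abs
  have hwZ : Integrable (fun p : Euc N × ℝ => w p.1 p.2 * Z p.1 p.2) (volume.prod volume) :=
    h.integrable_w.mul_bdd h.measurable_Z.aestronglyMeasurable
      (Eventually.of_forall fun p => h.abs_Z_le p.1 p.2)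
  have hwi := h.integrable_w.abs.const_mul M
  have hρi : ∀ n, Integrable ((approxKernel N n).normed volume) := fun n =>
    integrable_testFn (isTestFn_approxKernel n)
  have hρm : ∀ n, Measurable ((approxKernel N n).normed volume) := fun n =>
    (isTestFn_approxKernel n).1.continuous.measurable
  have hρ1 : ∀ n, ∫ y, |(approxKernel N n).normed volume y| = 1 := fun n => by
    simp_rw [abs_of_nonneg ((approxKernel N n).nonneg_normed _)]
    exact (approxKernel N n).integral_normed
  have hWi := fun n => integrable_mollify_time h.measurable_w h.integrable_w (hρm n) (hρi n)
  have hAi := fun n => integrable_mollify_time (w := fun x t => |w x t|) habs h.integrable_w.abs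
    (hρm n) (hρi n)
  have hZb : ∀ n (p : Euc N × ℝ),
      |mollify (fun y => Z y p.2) ((approxKernel N n).normed volume) p.1| ≤ M := fun n p => by
    simpa [hρ1] using abs_mollify_le_of_bound (fun y => h.abs_Z_le y p.2) (hρi n) p.1
  have hWZi := fun n => (hWi n).mul_bdd
    (measurable_mollify_time h.measurable_Z (hρm n)).aestronglyMeasurable
    (Eventually.of_forall (hZb n))
  have hWA : ∀ n (p : Euc N × ℝ),
      |mollify (fun y => w y p.2) ((approxKernel N n).normed volume) p.1| ≤
        mollify (fun y => |w y p.2|) ((approxKernel N n).normed volume) p.1 := fun n p => by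
    have := abs_mollify_le (f := fun y => w y p.2) (g := (approxKernel N n).normed volume) p.1
    simpa only [abs_of_nonneg ((approxKernel N n).nonneg_normed _)] using this
  have hA : ∀ n, ∫ p : Euc N × ℝ, mollify (fun y => |w y p.2|) ((approxKernel N n).normed volume)
      p.1 ∂(volume.prod volume) = ∫ p : Euc N × ℝ, |w p.1 p.2| ∂(volume.prod volume) := fun n => by
    rw [integral_prod_symm _ (hAi n), integral_prod_symm _ h.integrable_w.abs]
    refine integral_congr_ae ?_
    filter_upwards [h.ae_integrable_w] with t ht
    rw [integral_mollify ht.abs (hρi n), (approxKernel N n).integral_normed, mul_one]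
  have key := integral_le_of_tendsto_of_nonneg (ν := (volume : Measure (Euc N)).prod volume)
    (F := fun n p => mollify (fun y => w y p.2) ((approxKernel N n).normed volume) p.1 *
      mollify (fun y => Z y p.2) ((approxKernel N n).normed volume) p.1 +
      M * mollify (fun y => |w y p.2|) ((approxKernel N n).normed volume) p.1)
    (G := fun p => w p.1 p.2 * Z p.1 p.2 + M * |w p.1 p.2|)
    (B := M * ∫ p : Euc N × ℝ, |w p.1 p.2| ∂(volume.prod volume))
    (fun n => (hWZi n).add ((hAi n).const_mul M))
    (fun n => Eventually.of_forall fun p => by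
      have h1 := mul_le_mul (hWA n p) (hZb n p) (abs_nonneg _) ((abs_nonneg _).trans (hWA n p))
      rw [← abs_mul] at h1
      have h2 := neg_abs_le (mollify (fun y => w y p.2) ((approxKernel N n).normed volume) p.1 *
        mollify (fun y => Z y p.2) ((approxKernel N n).normed volume) p.1)
      simp only [Pi.zero_apply]
      linarith)
    (fun n => by
      rw [integral_add (hWZi n) ((hAi n).const_mul M), integral_const_mul, hA n]
      have := h.integral_mollify_mul_mollify_nonpos hμ hT (isTestFn_approxKernel n)
      linarith)
    (hwZ.add hwi)
    (by
      filter_upwards [ae_tendsto_mollify_approxKernel h.measurable_w h.abs_w_le,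
        ae_tendsto_mollify_approxKernel h.measurable_Z h.abs_Z_le,
        ae_tendsto_mollify_approxKernel (w := fun x t => |w x t|) (M := M) habs
          (fun x t => by simpa using h.abs_w_le x t)] with p h1 h2 h3
      exact (h1.mul h2).add (h3.const_mul M))
  rw [integral_add hwZ hwi, integral_const_mul] at key
  linarith

theorem ae_eq_zero (h : IsSolutionGap μ T M w Z) (hμ : IsLevyMeasure μ) (hT : 0 < T)
    (hnonneg : ∀ x t, 0 ≤ w x t * Z x t) (hzero : ∀ x t, w x t * Z x t = 0 → Z x t = 0) :
    ∀ᵐ p : Euc N × ℝ ∂(volume.prod volume), w p.1 p.2 = 0 := by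
  have hwZ : Integrable (fun p : Euc N × ℝ => w p.1 p.2 * Z p.1 p.2) (volume.prod volume) :=
    h.integrable_w.mul_bdd h.measurable_Z.aestronglyMeasurable
      (Eventually.of_forall fun p => h.abs_Z_le p.1 p.2)
  have h0 := (integral_eq_zero_iff_of_nonneg (fun p : Euc N × ℝ => hnonneg p.1 p.2) hwZ).1
    (le_antisymm (h.integral_mul_nonpos hμ hT) (integral_nonneg fun p => hnonneg p.1 p.2))
  have hZ0 : ∀ᵐ x, ∀ᵐ t, Z x t = 0 := by
    have : ∀ᵐ p : Euc N × ℝ ∂(volume.prod volume), Z p.1 p.2 = 0 := by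
      filter_upwards [h0] with p hp using hzero _ _ hp
    exact Measure.ae_ae_of_ae_prod this
  have hU : ∀ t, primitive Z t =ᵐ[volume] 0 := fun t => by
    filter_upwards [hZ0] with x hx
    exact intervalIntegral.integral_zero_ae (hx.mono fun s hs _ => hs)
  have hW : ∀ n, ∀ᵐ p : Euc N × ℝ ∂(volume.prod volume),
      mollify (fun y => w y p.2) ((approxKernel N n).normed volume) p.1 = 0 := fun n => by
    have hm := measurable_mollify_time h.measurable_w
      (isTestFn_approxKernel n).1.continuous.measurable
    refine (Measure.ae_prod_iff_ae_ae (measurableSet_eq_fun hm measurable_const)).2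
      (Eventually.of_forall fun x => ?_)
    filter_upwards [h.mollify_ae_eq_symLop hμ hT (isTestFn_approxKernel n) x] with t ht
    by_cases htT : t ∈ Ioo 0 T
    · rw [ht htT, mollify_eq_zero (hU t)]
      simp [symLop, secondDiff]
    · simp [h.mollify_w_eq_zero htT]
  filter_upwards [ae_all_iff.2 hW, ae_tendsto_mollify_approxKernel h.measurable_w h.abs_w_le]
    with p h1 h2
  simp only [h1] at h2
  exact tendsto_nhds_unique h2 tendsto_const_nhds

end IsSolutionGap

theorem QTvol_eq_restrict (N : ℕ) (T : ℝ) :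
    QTvol N T = ((volume : Measure (Euc N)).prod volume).restrict (univ ×ˢ Ioo 0 T) := by
  rw [← Measure.prod_restrict, Measure.restrict_univ, QTvol]

theorem exists_bounded_representative {T : ℝ} {u : Euc N → ℝ → ℝ} (hu : MemLinfQT T u) :
    ∃ C, ∃ u' : Euc N → ℝ → ℝ, Measurable (fun p : Euc N × ℝ => u' p.1 p.2) ∧
      (∀ x t, |u' x t| ≤ C) ∧ ∀ᵐ p ∂(QTvol N T), u p.1 p.2 = u' p.1 p.2 := by
  obtain ⟨hm, C, hC⟩ := hu
  refine ⟨|C|, fun x t => max (-|C|) (min |C| (hm.mk _ (x, t))), ?_, fun x t => ?_, ?_⟩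
  · exact measurable_const.max (measurable_const.min hm.stronglyMeasurable_mk.measurable)
  · exact abs_le.2 ⟨le_max_left _ _, max_le (neg_le_self (abs_nonneg C)) (min_le_left _ _)⟩
  · filter_upwards [hm.ae_eq_mk, hC] with p h1 h2
    have h3 := abs_le.1 (h2.trans (le_abs_self C))
    rw [← h1, min_eq_right h3.2, max_eq_right h3.1]

theorem isSTTestFn_mul {T : ℝ} {η : Euc N → ℝ} {θ : ℝ → ℝ} (hη : IsTestFn η)
    (hθ : ContDiff ℝ (⊤ : ℕ∞) θ) (hθc : HasCompactSupport θ) (hθT : tsupport θ ⊆ Iio T) :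
    IsSTTestFn T fun y s => η y * θ s := by
  have hsub : Function.support (Function.uncurry fun (y : Euc N) s => η y * θ s) ⊆
      tsupport η ×ˢ tsupport θ := fun p hp => by
    have hp' : η p.1 * θ p.2 ≠ 0 := hp
    exact ⟨subset_tsupport _ (left_ne_zero_of_mul hp'),
      subset_tsupport _ (right_ne_zero_of_mul hp')⟩
  have hK : IsCompact (tsupport η ×ˢ tsupport θ) := hη.2.isCompact.prod hθc.isCompact
  exact ⟨(hη.1.comp contDiff_fst).mul (hθ.comp contDiff_snd),
    HasCompactSupport.of_support_subset_isCompact hK hsub,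
    fun p hp => hθT (closure_minimal hsub hK.isClosed hp).2⟩

theorem Lop_mul_const (hμ : IsLevyMeasure μ) {η : Euc N → ℝ} (hη : IsTestFn η) (c : ℝ)
    (x : Euc N) : Lop μ (fun y => η y * c) x = Lop μ η x * c := by
  have hc : IsTestFn fun y => η y * c := ⟨hη.1.mul contDiff_const, hη.2.mul_right⟩
  rw [Lop_eq_symLop hμ hη, Lop_eq_symLop hμ hc]
  unfold symLop
  rw [mul_assoc, ← integral_mul_const]
  congr 2
  funext z
  simp only [secondDiff]
  ring

section Weak

variable {T : ℝ} {φ : ℝ → ℝ} {u u' : Euc N → ℝ → ℝ} {η : Euc N → ℝ} {θ : ℝ → ℝ} {C : ℝ}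

theorem integrable_mul_mul (hu : Measurable fun p : Euc N × ℝ => u p.1 p.2)
    (hC : ∀ x t, |u x t| ≤ C) (hη : Integrable η) (hθ : Continuous θ)
    (hθc : HasCompactSupport θ) :
    Integrable (fun p : Euc N × ℝ => u p.1 p.2 * (η p.1 * θ p.2)) (QTvol N T) :=
  (hη.mul_prod (hθ.integrable_of_hasCompactSupport hθc).restrict).bdd_mul
    hu.aestronglyMeasurable (Eventually.of_forall fun p => hC p.1 p.2)

/-- The distributional formulation for a product test function and a representative. -/
theorem integral_representative_add (hμ : IsLevyMeasure μ) {u0 : Euc N → ℝ}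
    (hsol : IsDistSolOp T (Lop μ) φ u0 u) (hae : ∀ᵐ p ∂(QTvol N T), u p.1 p.2 = u' p.1 p.2)
    (hη : IsTestFn η) (hθ : ContDiff ℝ (⊤ : ℕ∞) θ) (hθc : HasCompactSupport θ)
    (hθT : tsupport θ ⊆ Iio T) :
    (∫ t in Ioo 0 T, ∫ x, (u' x t * (η x * deriv θ t) + φ (u' x t) * (Lop μ η x * θ t))) +
      ∫ x, u0 x * (η x * θ 0) = 0 := by
  refine Eq.trans ?_ (hsol _ (isSTTestFn_mul hη hθ hθc hθT))
  congr 1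
  refine integral_congr_ae ?_
  have hae' : ∀ᵐ t ∂(volume.restrict (Ioo 0 T)), ∀ᵐ x, u x t = u' x t := by
    have := Measure.measurePreserving_swap.quasiMeasurePreserving.ae
      (show ∀ᵐ p ∂((volume : Measure (Euc N)).prod
      ((volume : Measure ℝ).restrict (Ioo 0 T))), u p.1 p.2 = u' p.1 p.2 from hae)
    exact Measure.ae_ae_of_ae_prod this
  filter_upwards [hae'] with t ht
  refine integral_congr_ae ?_
  filter_upwards [ht] with x hx
  rw [hx, Lop_mul_const hμ hη, deriv_const_mul _ (hθ.differentiable (by simp)).differentiableAt]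

end Weak

theorem exists_isSolutionGap {T : ℝ} {φ : ℝ → ℝ} (hφ : Continuous φ) (hμ : IsLevyMeasure μ)
    {u0 : Euc N → ℝ} {u v u' v' : Euc N → ℝ → ℝ} {C : ℝ}
    (hsu : IsDistSolOp T (Lop μ) φ u0 u) (hsv : IsDistSolOp T (Lop μ) φ u0 v)
    (hu1 : MemL1QT T fun x t => u x t - u0 x) (hv1 : MemL1QT T fun x t => v x t - u0 x)
    (hu : Measurable fun p : Euc N × ℝ => u' p.1 p.2) (huC : ∀ x t, |u' x t| ≤ C)
    (huae : ∀ᵐ p ∂(QTvol N T), u p.1 p.2 = u' p.1 p.2)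
    (hv : Measurable fun p : Euc N × ℝ => v' p.1 p.2) (hvC : ∀ x t, |v' x t| ≤ C)
    (hvae : ∀ᵐ p ∂(QTvol N T), v p.1 p.2 = v' p.1 p.2) :
    ∃ M, IsSolutionGap μ T M
      (fun x => (Ioo 0 T).indicator fun t => u' x t - v' x t)
      (fun x => (Ioo 0 T).indicator fun t => φ (u' x t) - φ (v' x t)) := by
  obtain ⟨K, hK⟩ := (isCompact_Icc (a := -C) (b := C)).exists_bound_of_continuousOn hφ.continuousOn
  have hK' : ∀ a, |a| ≤ C → |φ a| ≤ K := fun a ha => hK a (abs_le.1 ha)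
  have hC0 : 0 ≤ C := (abs_nonneg _).trans (huC 0 0)
  have hK0 : 0 ≤ K := (abs_nonneg _).trans (hK' 0 (by simpa using hC0))
  have hφu : Measurable fun p : Euc N × ℝ => φ (u' p.1 p.2) := hφ.measurable.comp hu
  have hφv : Measurable fun p : Euc N × ℝ => φ (v' p.1 p.2) := hφ.measurable.comp hv
  have hS : MeasurableSet (univ ×ˢ Ioo (0 : ℝ) T : Set (Euc N × ℝ)) :=
    MeasurableSet.univ.prod measurableSet_Ioo
  have hind : ∀ f : Euc N → ℝ → ℝ, (fun p : Euc N × ℝ => (Ioo 0 T).indicator (f p.1) p.2) =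
      (univ ×ˢ Ioo 0 T).indicator fun p => f p.1 p.2 := fun f => by
    funext p
    simp [indicator]
  have hw_le : ∀ x t, |u' x t - v' x t| ≤ 2 * C := fun x t =>
    (abs_sub _ _).trans (by linarith [huC x t, hvC x t])
  have hZ_le : ∀ x t, |φ (u' x t) - φ (v' x t)| ≤ 2 * K := fun x t =>
    (abs_sub _ _).trans (by linarith [hK' _ (huC x t), hK' _ (hvC x t)])
  refine ⟨max (2 * C) (2 * K), ?_, ?_, fun x t => ?_, fun x t => ?_, fun x t ht => ?_,
    fun x t ht => ?_, ?_, fun δ hδ => ?_, fun η θ hη hθ hθc hθT => ?_⟩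
  · rw [hind fun x t => u' x t - v' x t]
    exact (hu.sub hv).indicator hS
  · rw [hind fun x t => φ (u' x t) - φ (v' x t)]
    exact (hφu.sub hφv).indicator hS
  · by_cases ht : t ∈ Ioo 0 T
    · simpa only [indicator_of_mem ht] using (hw_le x t).trans (le_max_left _ _)
    · simp only [indicator_of_notMem ht, abs_zero]
      positivity
  · by_cases ht : t ∈ Ioo 0 T
    · simpa only [indicator_of_mem ht] using (hZ_le x t).trans (le_max_right _ _)
    · simp only [indicator_of_notMem ht, abs_zero]
      positivity
  · exact indicator_of_notMem ht _
  · exact indicator_of_notMem ht _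
  · rw [hind fun x t => u' x t - v' x t, integrable_indicator_iff hS, IntegrableOn,
      ← QTvol_eq_restrict]
    refine (Integrable.sub hu1 hv1).congr ?_
    filter_upwards [huae, hvae] with p h1 h2
    simp [h1, h2]
  · have huc := isCompact_Icc.uniformContinuousOn_of_continuous
      (hφ.continuousOn (s := Icc (-C) C))
    obtain ⟨ε, hε, h⟩ := Metric.uniformContinuousOn_iff.1 huc δ hδ
    refine ⟨2 * K / ε, by positivity, fun x t => ?_⟩
    by_cases ht : t ∈ Ioo 0 T
    · simp only [indicator_of_mem ht]
      rcases lt_or_ge |u' x t - v' x t| ε with hlt | hge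
      · have h1 := (h _ (abs_le.1 (huC x t)) _ (abs_le.1 (hvC x t)) hlt).le
        have h2 : 0 ≤ 2 * K / ε * |u' x t - v' x t| := by positivity
        rw [Real.dist_eq] at h1
        linarith
      · have h2 : 2 * K / ε * ε ≤ 2 * K / ε * |u' x t - v' x t| :=
          mul_le_mul_of_nonneg_left hge (by positivity)
        rw [div_mul_cancel₀ _ hε.ne'] at h2
        linarith [hZ_le x t]
    · simp only [indicator_of_notMem ht, abs_zero]
      linarith
  · have hηi := integrable_testFn hη
    have hLi : Integrable (Lop μ η) := by
      rw [Lop_eq_symLop hμ hη]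
      exact integrable_symLop hμ hη
    have hθ'c : HasCompactSupport (deriv θ) := hθc.deriv
    have hθ' : Continuous (deriv θ) := hθ.continuous_deriv (by simp)
    have hFu := (integrable_mul_mul (T := T) hu huC hηi hθ' hθ'c).add
      (integrable_mul_mul (T := T) hφu (fun x t => hK' _ (huC x t)) hLi hθ.continuous hθc)
    have hFv := (integrable_mul_mul (T := T) hv hvC hηi hθ' hθ'c).add
      (integrable_mul_mul (T := T) hφv (fun x t => hK' _ (hvC x t)) hLi hθ.continuous hθc)
    have eu := integral_representative_add hμ hsu huae hη hθ hθc hθT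
    have ev := integral_representative_add hμ hsv hvae hη hθ hθc hθT
    have hsub := integral_sub (Integrable.integral_prod_right hFu)
      (Integrable.integral_prod_right hFv)
    simp only [Pi.add_apply] at hsub
    refine Eq.trans (Eq.trans ?_ hsub) (sub_eq_zero.2 (add_right_cancel (eu.trans ev.symm)))
    refine integral_congr_ae ?_
    filter_upwards [Integrable.prod_left_ae hFu, Integrable.prod_left_ae hFv,
      ae_restrict_mem measurableSet_Ioo] with t h1 h2 ht
    have hmw : Measurable fun x => u' x t - v' x t := (hu.sub hv).comp measurable_prodMk_right
    have hmZ : Measurable fun x => φ (u' x t) - φ (v' x t) :=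
      (hφu.sub hφv).comp measurable_prodMk_right
    have i1 : Integrable fun x => (u' x t - v' x t) * η x :=
      hηi.bdd_mul hmw.aestronglyMeasurable (Eventually.of_forall fun x => hw_le x t)
    have i2 : Integrable fun x => (φ (u' x t) - φ (v' x t)) * Lop μ η x :=
      hLi.bdd_mul hmZ.aestronglyMeasurable (Eventually.of_forall fun x => hZ_le x t)
    simp only [indicator_of_mem ht]
    simp only [Pi.add_apply] at h1 h2
    rw [← integral_sub h1 h2, ← integral_const_mul, ← integral_const_mul,
      ← integral_add (i1.const_mul _) (i2.const_mul _)]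
    refine integral_congr_ae (Eventually.of_forall fun x => ?_)
    ring

end LevyUniqueness

/-- Uniqueness for the initial value problem (Corollary 2.3).
There is at most one distributional solution `u` of `∂_t u − L^μ[φ(u)] = 0`, `u(·,0) = u₀`,
with `u ∈ L^∞(Q_T)` and `u − u₀ ∈ L¹(Q_T)`. -/
theorem uniqueness_for_ivp
    (N : ℕ) (hN : 0 < N) (T : ℝ) (hT : 0 < T)
    (φ : ℝ → ℝ) (hφc : Continuous φ) (hφm : Monotone φ)
    (μ : Measure (Euc N)) (hμ : IsLevyMeasure μ)
    (u0 : Euc N → ℝ) (hu0 : MemLinfRn u0)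
    (u v : Euc N → ℝ → ℝ)
    (huinf : MemLinfQT T u) (hvinf : MemLinfQT T v)
    (husol : IsDistSolOp T (Lop μ) φ u0 u)
    (hvsol : IsDistSolOp T (Lop μ) φ u0 v)
    (huL1 : MemL1QT T (fun x t => u x t - u0 x))
    (hvL1 : MemL1QT T (fun x t => v x t - u0 x)) :
    ∀ᵐ p ∂(QTvol N T), u p.1 p.2 = v p.1 p.2 := by
  obtain ⟨C₁, u', hu, huC, huae⟩ := LevyUniqueness.exists_bounded_representative huinf
  obtain ⟨C₂, v', hv, hvC, hvae⟩ := LevyUniqueness.exists_bounded_representative hvinf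
  obtain ⟨M, hgap⟩ := LevyUniqueness.exists_isSolutionGap hφc hμ husol hvsol huL1 hvL1
    hu (fun x t => (huC x t).trans (le_max_left C₁ C₂)) huae
    hv (fun x t => (hvC x t).trans (le_max_right C₁ C₂)) hvae
  have hw := hgap.ae_eq_zero hμ hT
    (fun x t => by
      by_cases ht : t ∈ Ioo 0 T
      · simp only [indicator_of_mem ht]
        rcases le_total (u' x t) (v' x t) with h | h
        · exact mul_nonneg_of_nonpos_of_nonpos (sub_nonpos.2 h) (sub_nonpos.2 (hφm h))
        · exact mul_nonneg (sub_nonneg.2 h) (sub_nonneg.2 (hφm h))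
      · simp [indicator_of_notMem ht])
    (fun x t h => by
      by_cases ht : t ∈ Ioo 0 T
      · simp only [indicator_of_mem ht] at h ⊢
        rcases mul_eq_zero.1 h with h | h
        · rw [sub_eq_zero.1 h, sub_self]
        · exact h
      · exact indicator_of_notMem ht _)
  rw [LevyUniqueness.QTvol_eq_restrict] at *
  filter_upwards [huae, hvae, ae_restrict_of_ae hw,
    ae_restrict_mem (MeasurableSet.univ.prod measurableSet_Ioo)] with p h1 h2 h3 h4
  rw [indicator_of_mem h4.2] at h3
  rw [h1, h2, sub_eq_zero.1 h3]
end

section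
/- (Stability.) Let T > 0, let L be a map sending each ψ ∈ C_c^∞(ℝ^N) to a function L[ψ] ∈ L¹(ℝ^N), let μ_n be Lévy measures on ℝ^N \ {0} for n ∈ ℕ, let φ_n and φ be continuous nondecreasing functions on ℝ, and let u_n, u ∈ L^∞(Q_T). Suppose each u_n satisfies ∫₀^T ∫_{ℝ^N} ( u_n ∂_t ψ + φ_n(u_n) L^{μ_n}[ψ(·,t)] ) dx dt = 0 for all ψ ∈ C_c^∞(Q_T), sup_n ‖u_n‖_{L^∞(Q_T)} < ∞, and: (i) L^{μ_n}[ψ] → L[ψ] in L¹(ℝ^N) for every ψ ∈ C_c^∞(ℝ^N); (ii) φ_n → φ locally uniformly on ℝ; (iii) u_n → u pointwise a.e. in Q_T. Then ∫₀^T ∫_{ℝ^N} ( u ∂_t ψ + φ(u) L[ψ(·,t)] ) dx dt = 0 for all ψ ∈ C_c^∞(Q_T), i.e. u is a distributional solution of ∂_t u − L[φ(u)] = 0 in Q_T. -/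
open MeasureTheory Set Filter

open scoped ENNReal Topology

section LevyOperator

variable {N : ℕ}

lemma IsLevyMeasure.integrable_min {μ : Measure (Euc N)} (hμ : IsLevyMeasure μ) :
    Integrable (fun z => min (‖z‖ ^ 2) 1) μ := by
  refine (lintegral_ofReal_ne_top_iff_integrable ?_ ?_).1 hμ.2.2
  · exact Continuous.aestronglyMeasurable (by fun_prop)
  · exact Eventually.of_forall fun z => by positivity

lemma IsLevyMeasure.sFinite {μ : Measure (Euc N)} (hμ : IsLevyMeasure μ) : SFinite μ := by
  have hmeas : Measurable fun z : Euc N => ENNReal.ofReal (min (‖z‖ ^ 2) 1) := by fun_prop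
  have hne : ∀ᵐ z ∂μ, ENNReal.ofReal (min (‖z‖ ^ 2) 1) ≠ 0 := by
    have h0 : ∀ᵐ z ∂μ, z ≠ 0 := by
      rw [ae_iff]
      simpa using hμ.1
    filter_upwards [h0] with z hz
    have : 0 < ‖z‖ := norm_pos_iff.2 hz
    rw [Ne, ENNReal.ofReal_eq_zero, not_le]
    positivity
  have := isFiniteMeasure_withDensity hμ.2.2
  rw [← withDensity_inv_same hmeas hne (Eventually.of_forall fun z => ENNReal.ofReal_ne_top)]
  infer_instance

/-- The integrand of `Lop`, as a function of the base point and of the jump. -/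
noncomputable def levyIntegrand (ψ : Euc N → ℝ) (x z : Euc N) : ℝ :=
  ψ (x + z) - ψ x - (if ‖z‖ ≤ 1 then fderiv ℝ ψ x z else 0)

/-- Quantitative control of a test function: a bound `K` for its values and for its second
order Taylor remainder, and a radius `R` outside of which it vanishes. -/
structure LevyBound (ψ : Euc N → ℝ) (K R : ℝ) : Prop where
  contDiff : ContDiff ℝ 1 ψ
  abs_le : ∀ x, |ψ x| ≤ K
  taylor : ∀ x z, |ψ (x + z) - ψ x - fderiv ℝ ψ x z| ≤ K * ‖z‖ ^ 2
  eq_zero : ∀ x, R < ‖x‖ → ψ x = 0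

/-- The slice at time `t` of a space-time function has the partial derivative of the function. -/
lemma fderiv_slice {Ψ : Euc N × ℝ → ℝ} (hΨ : ContDiff ℝ 1 Ψ) (x : Euc N) (t : ℝ) (z : Euc N) :
    fderiv ℝ (fun y => Ψ (y, t)) x z = fderiv ℝ Ψ (x, t) (z, 0) := by
  have h1 : HasFDerivAt Ψ (fderiv ℝ Ψ (x, t)) (x, t) :=
    (hΨ.differentiable one_ne_zero).differentiableAt.hasFDerivAt
  have h2 : HasFDerivAt (fun y => Ψ (y, t)) _ x := h1.comp x (hasFDerivAt_prodMk_left x t)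
  rw [h2.fderiv]
  simp

lemma stronglyMeasurable_levyIntegrand_slice {Ψ : Euc N × ℝ → ℝ} (hΨ : ContDiff ℝ 1 Ψ) :
    StronglyMeasurable fun q : (Euc N × ℝ) × Euc N =>
      levyIntegrand (fun y => Ψ (y, q.1.2)) q.1.1 q.2 := by
  have hc : Continuous Ψ := hΨ.continuous
  have hd : Continuous fun q : (Euc N × ℝ) × Euc N => fderiv ℝ Ψ q.1 (q.2, 0) :=
    ((hΨ.continuous_fderiv one_ne_zero).comp continuous_fst).clm_apply (by fun_prop)
  have hs : MeasurableSet {q : (Euc N × ℝ) × Euc N | ‖q.2‖ ≤ 1} :=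
    (isClosed_le (by fun_prop) (by fun_prop)).measurableSet
  simp only [levyIntegrand, fderiv_slice hΨ]
  refine StronglyMeasurable.sub (Continuous.stronglyMeasurable (by fun_prop)) ?_
  exact StronglyMeasurable.ite hs hd.stronglyMeasurable stronglyMeasurable_const

lemma stronglyMeasurable_Lop_slice {μ : Measure (Euc N)} [SFinite μ] {Ψ : Euc N × ℝ → ℝ}
    (hΨ : ContDiff ℝ 1 Ψ) :
    StronglyMeasurable fun p : Euc N × ℝ => Lop μ (fun y => Ψ (y, p.2)) p.1 :=
  (stronglyMeasurable_levyIntegrand_slice hΨ).integral_prod_right'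

lemma stronglyMeasurable_levyIntegrand {ψ : Euc N → ℝ} (hψ : ContDiff ℝ 1 ψ) :
    StronglyMeasurable (Function.uncurry (levyIntegrand ψ)) :=
  (stronglyMeasurable_levyIntegrand_slice (Ψ := fun p => ψ p.1)
    (hψ.comp contDiff_fst)).comp_measurable
      (g := fun q : Euc N × Euc N => ((q.1, (0 : ℝ)), q.2)) (by fun_prop)

lemma stronglyMeasurable_Lop {μ : Measure (Euc N)} [SFinite μ] {ψ : Euc N → ℝ}
    (hψ : ContDiff ℝ 1 ψ) : StronglyMeasurable (Lop μ ψ) :=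
  (stronglyMeasurable_levyIntegrand hψ).integral_prod_right'

namespace LevyBound

variable {ψ : Euc N → ℝ} {K R : ℝ}

lemma nonneg (h : LevyBound ψ K R) : 0 ≤ K := (abs_nonneg _).trans (h.abs_le 0)

lemma fderiv_eq_zero (h : LevyBound ψ K R) {x : Euc N} (hx : R < ‖x‖) : fderiv ℝ ψ x = 0 := by
  have : ψ =ᶠ[𝓝 x] fun _ => 0 := by
    filter_upwards [(isOpen_lt continuous_const continuous_norm).mem_nhds hx] with y hy
    exact h.eq_zero y hy
  rw [this.fderiv_eq]
  simp

lemma abs_levyIntegrand_le (h : LevyBound ψ K R) (x z : Euc N) :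
    |levyIntegrand ψ x z| ≤ 2 * K * min (‖z‖ ^ 2) 1 := by
  have hK := h.nonneg
  unfold levyIntegrand
  split_ifs with hz
  · rw [min_eq_left (pow_le_one₀ (norm_nonneg z) hz)]
    refine (h.taylor x z).trans ?_
    gcongr
    linarith
  · rw [min_eq_right (one_le_pow₀ (not_le.1 hz).le), sub_zero]
    have := abs_sub (ψ (x + z)) (ψ x)
    linarith [h.abs_le x, h.abs_le (x + z)]

lemma integrable_levyIntegrand (h : LevyBound ψ K R) {μ : Measure (Euc N)}
    (hμ : IsLevyMeasure μ) (x : Euc N) : Integrable (levyIntegrand ψ x) μ := by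
  refine (hμ.integrable_min.const_mul (2 * K)).mono' ?_ ?_
  · exact ((stronglyMeasurable_levyIntegrand h.contDiff).comp_measurable
      measurable_prodMk_left).aestronglyMeasurable
  · exact Eventually.of_forall fun z => h.abs_levyIntegrand_le x z

lemma lintegral_levyIntegrand_le (h : LevyBound ψ K R) (z : Euc N) :
    ∫⁻ x, ‖levyIntegrand ψ x z‖ₑ ≤
      ENNReal.ofReal (min (‖z‖ ^ 2) 1) *
        (ENNReal.ofReal (2 * K) * volume (Metric.closedBall (0 : Euc N) (R + 1))) := by
  have hK := h.nonneg
  rw [← mul_assoc, mul_comm (ENNReal.ofReal (min _ _)), ← ENNReal.ofReal_mul (by positivity)]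
  by_cases hz : ‖z‖ ≤ 1
  · rw [← setLIntegral_const, ← lintegral_indicator Metric.isClosed_closedBall.measurableSet]
    refine lintegral_mono fun x => ?_
    by_cases hx : x ∈ Metric.closedBall (0 : Euc N) (R + 1)
    · rw [indicator_of_mem hx, Real.enorm_eq_ofReal_abs]
      exact ENNReal.ofReal_le_ofReal (h.abs_levyIntegrand_le x z)
    · rw [mem_closedBall_zero_iff, not_le] at hx
      have h1 : R < ‖x + z‖ := by
        have := norm_sub_le (x + z) z
        rw [add_sub_cancel_right] at this
        linarith
      have h2 : R < ‖x‖ := by linarith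
      simp [levyIntegrand, h.eq_zero _ h1, h.eq_zero _ h2, h.fderiv_eq_zero h2]
  · have hψ : ∫⁻ x, ‖ψ x‖ₑ ≤
        ENNReal.ofReal K * volume (Metric.closedBall (0 : Euc N) (R + 1)) := by
      rw [← setLIntegral_const, ← lintegral_indicator Metric.isClosed_closedBall.measurableSet]
      refine lintegral_mono fun x => ?_
      by_cases hx : x ∈ Metric.closedBall (0 : Euc N) (R + 1)
      · rw [indicator_of_mem hx, Real.enorm_eq_ofReal_abs]
        exact ENNReal.ofReal_le_ofReal (h.abs_le x)
      · rw [mem_closedBall_zero_iff, not_le] at hx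
        simp [h.eq_zero x (by linarith)]
    have hmeas : Measurable fun x => ‖ψ x‖ₑ := h.contDiff.continuous.measurable.enorm
    calc ∫⁻ x, ‖levyIntegrand ψ x z‖ₑ ≤ ∫⁻ x, (‖ψ (x + z)‖ₑ + ‖ψ x‖ₑ) := by
          refine lintegral_mono fun x => ?_
          simp only [levyIntegrand, if_neg hz, sub_zero]
          exact enorm_sub_le
      _ = (∫⁻ x, ‖ψ x‖ₑ) + ∫⁻ x, ‖ψ x‖ₑ := by
          rw [lintegral_add_right _ hmeas, lintegral_add_right_eq_self (fun x => ‖ψ x‖ₑ) z]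
      _ ≤ _ := by
          rw [min_eq_right (one_le_pow₀ (not_le.1 hz).le), mul_one, two_mul,
            ENNReal.ofReal_add hK hK, add_mul]
          exact add_le_add hψ hψ

lemma lintegral_Lop_le (h : LevyBound ψ K R) {μ : Measure (Euc N)} (hμ : IsLevyMeasure μ) :
    ∫⁻ x, ‖Lop μ ψ x‖ₑ ≤ ENNReal.ofReal ((∫ z, min (‖z‖ ^ 2) 1 ∂μ) *
      (2 * K * volume.real (Metric.closedBall (0 : Euc N) (R + 1)))) := by
  have := hμ.sFinite
  have hK := h.nonneg
  have hmass : (0 : ℝ) ≤ ∫ z, min (‖z‖ ^ 2) 1 ∂μ := integral_nonneg fun z => by positivity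
  calc ∫⁻ x, ‖Lop μ ψ x‖ₑ ≤ ∫⁻ x, ∫⁻ z, ‖levyIntegrand ψ x z‖ₑ ∂μ :=
        lintegral_mono fun x => enorm_integral_le_lintegral_enorm _
    _ = ∫⁻ z, (∫⁻ x, ‖levyIntegrand ψ x z‖ₑ) ∂μ :=
        lintegral_lintegral_swap
          (stronglyMeasurable_levyIntegrand h.contDiff).enorm.aemeasurable
    _ ≤ ∫⁻ z, ENNReal.ofReal (min (‖z‖ ^ 2) 1) *
        (ENNReal.ofReal (2 * K) * volume (Metric.closedBall (0 : Euc N) (R + 1))) ∂μ :=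
        lintegral_mono fun z => h.lintegral_levyIntegrand_le z
    _ = _ := by
        rw [lintegral_mul_const _ (by fun_prop), ENNReal.ofReal_mul hmass,
          ENNReal.ofReal_mul (p := 2 * K) (by positivity), ofReal_measureReal measure_closedBall_lt_top.ne,
          ofReal_integral_eq_lintegral_ofReal hμ.integrable_min
            (Eventually.of_forall fun z => by positivity)]

lemma integrable_Lop (h : LevyBound ψ K R) {μ : Measure (Euc N)} (hμ : IsLevyMeasure μ) :
    Integrable (Lop μ ψ) := by
  have := hμ.sFinite
  exact ⟨(stronglyMeasurable_Lop h.contDiff).aestronglyMeasurable,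
    (h.lintegral_Lop_le hμ).trans_lt ENNReal.ofReal_lt_top⟩

lemma integral_abs_Lop_le (h : LevyBound ψ K R) {μ : Measure (Euc N)} (hμ : IsLevyMeasure μ) :
    ∫ x, |Lop μ ψ x| ≤ (∫ z, min (‖z‖ ^ 2) 1 ∂μ) *
      (2 * K * volume.real (Metric.closedBall (0 : Euc N) (R + 1))) := by
  have hK := h.nonneg
  have hmass : (0 : ℝ) ≤ ∫ z, min (‖z‖ ^ 2) 1 ∂μ := integral_nonneg fun z => by positivity
  refine (ENNReal.ofReal_le_ofReal_iff (by positivity)).1 ?_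
  have := ofReal_integral_norm_eq_lintegral_enorm (h.integrable_Lop hμ)
  simp only [Real.norm_eq_abs] at this
  exact this.trans_le (h.lintegral_Lop_le hμ)

end LevyBound

/-- The second order Taylor remainder of a compactly supported smooth function is quadratic. -/
lemma exists_taylor_bound {E : Type*} [NormedAddCommGroup E] [NormedSpace ℝ E] {f : E → ℝ}
    (hf : ContDiff ℝ 2 f) (hs : HasCompactSupport f) :
    ∃ K : ℝ, ∀ x z, |f (x + z) - f x - fderiv ℝ f x z| ≤ K * ‖z‖ ^ 2 := by
  obtain ⟨C, hC⟩ := ContDiff.lipschitzWith_of_hasCompactSupport (n := 1) (hs.fderiv ℝ)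
    (hf.fderiv_right (m := 1) (by norm_num)) one_ne_zero
  refine ⟨C, fun x z => ?_⟩
  have key := Convex.norm_image_sub_le_of_norm_fderiv_le' (𝕜 := ℝ) (f := f) (C := C * ‖z‖)
    (s := Metric.closedBall x ‖z‖) (x := x) (y := x + z) (φ := fderiv ℝ f x)
    (fun y _ => (hf.differentiable two_ne_zero).differentiableAt)
    (fun y hy => by
      refine (hC.norm_sub_le y x).trans ?_
      gcongr
      simpa [dist_eq_norm] using hy)
    (convex_closedBall x ‖z‖) (by simp) (by simp)
  rw [add_sub_cancel_left] at key
  rw [← Real.norm_eq_abs]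
  exact key.trans_eq (by ring)

lemma exists_levyBound_slice {Ψ : Euc N × ℝ → ℝ} (hΨ : ContDiff ℝ 2 Ψ)
    (hs : HasCompactSupport Ψ) : ∃ K R, ∀ t, LevyBound (fun y => Ψ (y, t)) K R := by
  obtain ⟨K₁, hK₁⟩ := exists_taylor_bound hΨ hs
  obtain ⟨K₂, hK₂⟩ := hs.exists_bound_of_continuous hΨ.continuous
  obtain ⟨R, hR⟩ := hs.isCompact.isBounded.subset_closedBall 0
  have h1 : ContDiff ℝ 1 Ψ := hΨ.of_le (by norm_num)
  refine ⟨max K₁ K₂, R, fun t => ⟨?_, fun x => ?_, fun x z => ?_, fun x hx => ?_⟩⟩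
  · exact h1.comp (contDiff_id.prodMk contDiff_const)
  · exact (hK₂ (x, t)).trans (le_max_right _ _)
  · rw [fderiv_slice h1]
    have := hK₁ (x, t) (z, 0)
    simp only [Prod.mk_add_mk, add_zero, Prod.norm_mk, norm_zero, norm_nonneg,
      sup_of_le_left] at this
    refine this.trans ?_
    gcongr
    exact le_max_left _ _
  · by_contra hne
    have := hR (subset_tsupport _ (Function.mem_support.2 hne))
    rw [mem_closedBall_zero_iff, Prod.norm_mk] at this
    exact absurd ((le_max_left _ _).trans this) (not_le.2 hx)

lemma IsTestFn.exists_levyBound {ψ : Euc N → ℝ} (hψ : IsTestFn ψ) :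
    ∃ K R, LevyBound ψ K R := by
  have h2 : ContDiff ℝ 2 ψ := by exact_mod_cast contDiff_infty.1 hψ.1 2
  obtain ⟨K₁, hK₁⟩ := exists_taylor_bound h2 hψ.2
  obtain ⟨K₂, hK₂⟩ := hψ.2.exists_bound_of_continuous hψ.1.continuous
  obtain ⟨R, hR⟩ := hψ.2.isCompact.isBounded.subset_closedBall 0
  refine ⟨max K₁ K₂, R, h2.of_le (by norm_num), fun x => ?_, fun x z => ?_, fun x hx => ?_⟩
  · exact (hK₂ x).trans (le_max_right _ _)
  · refine (hK₁ x z).trans ?_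
    gcongr
    exact le_max_left _ _
  · by_contra hne
    have := hR (subset_tsupport _ (Function.mem_support.2 hne))
    rw [mem_closedBall_zero_iff] at this
    exact absurd this (not_le.2 hx)

/-- There is a test function on which every Lévy operator is controlled from above, near the
origin, by the total mass of the Lévy measure. -/
lemma exists_testFn_levyIntegrand_le (N : ℕ) : ∃ ψ : Euc N → ℝ, IsTestFn ψ ∧
    ∀ x z, ‖x‖ ≤ 1 / 8 → levyIntegrand ψ x z ≤ -(1 / 2) * min (‖z‖ ^ 2) 1 := by
  let η : ContDiffBump (0 : Euc N) := ⟨1 / 2, 1, by norm_num, by norm_num⟩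
  let ψ : Euc N → ℝ := fun x => (1 - ‖x‖ ^ 2) * η x
  have hψ : ContDiff ℝ (⊤ : ℕ∞) ψ :=
    (contDiff_const.sub (contDiff_norm_sq ℝ)).mul η.contDiff
  refine ⟨ψ, ⟨hψ, η.hasCompactSupport.mul_left⟩, fun x z hx => ?_⟩
  have hin : ∀ y : Euc N, ‖y‖ ≤ 1 / 2 → ψ y = 1 - ‖y‖ ^ 2 := fun y hy => by
    have : η y = 1 := η.one_of_mem_closedBall (mem_closedBall_zero_iff.2 hy)
    simp [ψ, this]
  have hout : ∀ y : Euc N, 1 ≤ ‖y‖ → ψ y = 0 := fun y hy => by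
    have : η y = 0 := η.zero_of_le_dist (by rwa [dist_zero_right])
    simp [ψ, this]
  have hle : ∀ y : Euc N, ‖y‖ ≤ 1 → ψ y ≤ 1 - ‖y‖ ^ 2 := fun y hy =>
    mul_le_of_le_one_right (by nlinarith [norm_nonneg y]) η.le_one
  have hxx : ψ x = 1 - ‖x‖ ^ 2 := hin x (by linarith)
  have hd : fderiv ℝ ψ x z = -(2 * inner ℝ x z) := by
    have heq : ψ =ᶠ[𝓝 x] fun y => 1 - ‖y‖ ^ 2 := by
      have hx' : ‖x‖ < 1 / 2 := by linarith
      filter_upwards [(isOpen_lt continuous_norm continuous_const).mem_nhds hx'] with y hy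
      exact hin y (le_of_lt hy)
    rw [heq.fderiv_eq, ((hasStrictFDerivAt_norm_sq x).hasFDerivAt.const_sub 1).fderiv]
    simp
  have hsq : ‖x + z‖ ^ 2 = ‖x‖ ^ 2 + 2 * inner ℝ x z + ‖z‖ ^ 2 := norm_add_sq_real x z
  have hcs : inner ℝ x z ≤ ‖x‖ * ‖z‖ := real_inner_le_norm x z
  have hx0 := norm_nonneg x
  have hz0 := norm_nonneg z
  unfold levyIntegrand
  split_ifs with hz
  · rw [min_eq_left (pow_le_one₀ hz0 hz), hd, hxx]
    rcases le_total ‖x + z‖ 1 with h1 | h1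
    · nlinarith [hle _ h1]
    · rw [hout _ h1]
      nlinarith
  · rw [not_le] at hz
    rw [min_eq_right (one_le_pow₀ hz.le), hxx]
    have h2 : 7 / 8 ≤ ‖x + z‖ := by
      have := norm_sub_le (x + z) x
      rw [add_sub_cancel_left] at this
      linarith
    rcases le_total ‖x + z‖ 1 with h1 | h1
    · nlinarith [hle _ h1]
    · rw [hout _ h1]
      nlinarith

end LevyOperator

section Stability

variable {N : ℕ}

lemma exists_integral_abs_Lop_le {L : (Euc N → ℝ) → Euc N → ℝ} {μs : ℕ → Measure (Euc N)}
    (hμs : ∀ n, IsLevyMeasure (μs n)) {ψ : Euc N → ℝ} (hψ : IsTestFn ψ)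
    (hL : Integrable (L ψ))
    (hi : Tendsto (fun n => ∫ x, |Lop (μs n) ψ x - L ψ x|) atTop (𝓝 0)) :
    ∃ B, ∀ n, ∫ x, |Lop (μs n) ψ x| ≤ B := by
  obtain ⟨K, R, hb⟩ := hψ.exists_levyBound
  obtain ⟨B, hB⟩ := hi.bddAbove_range
  refine ⟨B + ∫ x, |L ψ x|, fun n => ?_⟩
  have hA := hb.integrable_Lop (hμs n)
  calc ∫ x, |Lop (μs n) ψ x| ≤ ∫ x, (|Lop (μs n) ψ x - L ψ x| + |L ψ x|) := by
        refine integral_mono hA.abs ((hA.sub hL).abs.add hL.abs) fun x => ?_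
        simpa using abs_add_le (Lop (μs n) ψ x - L ψ x) (L ψ x)
    _ = (∫ x, |Lop (μs n) ψ x - L ψ x|) + ∫ x, |L ψ x| := integral_add (hA.sub hL).abs hL.abs
    _ ≤ _ := by gcongr; exact hB (mem_range_self n)

/-- Convergence of the operators on test functions bounds the masses of the Lévy measures. -/
lemma exists_integral_min_le {L : (Euc N → ℝ) → Euc N → ℝ} {μs : ℕ → Measure (Euc N)}
    (hμs : ∀ n, IsLevyMeasure (μs n))
    (hL : ∀ ψ : Euc N → ℝ, IsTestFn ψ → Integrable (L ψ))
    (hi : ∀ ψ : Euc N → ℝ, IsTestFn ψ →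
      Tendsto (fun n => ∫ x, |Lop (μs n) ψ x - L ψ x|) atTop (𝓝 0)) :
    ∃ M, ∀ n, ∫ z, min (‖z‖ ^ 2) 1 ∂(μs n) ≤ M := by
  obtain ⟨ψ, hψ, hneg⟩ := exists_testFn_levyIntegrand_le N
  obtain ⟨B, hB⟩ := exists_integral_abs_Lop_le hμs hψ (hL ψ hψ) (hi ψ hψ)
  obtain ⟨K, R, hb⟩ := hψ.exists_levyBound
  set S := Metric.closedBall (0 : Euc N) (1 / 8)
  have hv : 0 < volume.real S :=
    ENNReal.toReal_pos (Metric.measure_closedBall_pos _ _ (by norm_num)).ne'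
      measure_closedBall_lt_top.ne
  refine ⟨2 * B / volume.real S, fun n => ?_⟩
  set m := ∫ z, min (‖z‖ ^ 2) 1 ∂(μs n)
  have hA := (hb.integrable_Lop (hμs n)).abs
  have hlow : ∀ x ∈ S, m / 2 ≤ |Lop (μs n) ψ x| := fun x hx => by
    have h1 : Lop (μs n) ψ x ≤ -(1 / 2) * m := by
      rw [← integral_const_mul]
      exact integral_mono (hb.integrable_levyIntegrand (hμs n) x)
        ((hμs n).integrable_min.const_mul _)
        fun z => hneg x z (mem_closedBall_zero_iff.1 hx)
    linarith [neg_abs_le (Lop (μs n) ψ x)]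
  have h2 := setIntegral_ge_of_const_le Metric.isClosed_closedBall.measurableSet
    measure_closedBall_lt_top.ne hlow hA.integrableOn
  have h3 : ∫ x in S, |Lop (μs n) ψ x| ≤ ∫ x, |Lop (μs n) ψ x| :=
    setIntegral_le_integral hA (Eventually.of_forall fun x => abs_nonneg _)
  rw [smul_eq_mul] at h2
  rw [le_div_iff₀ hv]
  linarith [hB n]

lemma exists_integral_abs_slice_le {g : Euc N × ℝ → ℝ} (hg : Continuous g)
    (hs : HasCompactSupport g) :
    ∃ B, ∀ t, Integrable (fun x => g (x, t)) ∧ ∫ x, |g (x, t)| ≤ B := by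
  obtain ⟨C, hC⟩ := hs.exists_bound_of_continuous hg
  obtain ⟨R, hR⟩ := hs.isCompact.isBounded.subset_closedBall 0
  set S := Metric.closedBall (0 : Euc N) R
  have hS : Integrable (S.indicator fun _ => C) :=
    (integrableOn_const measure_closedBall_lt_top.ne).integrable_indicator
      Metric.isClosed_closedBall.measurableSet
  have hle : ∀ t x, |g (x, t)| ≤ S.indicator (fun _ => C) x := fun t x => by
    by_cases hx : x ∈ S
    · rw [indicator_of_mem hx]
      exact hC (x, t)
    · have : g (x, t) = 0 := by
        by_contra hne
        have := hR (subset_tsupport _ (Function.mem_support.2 hne))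
        rw [mem_closedBall_zero_iff, Prod.norm_mk] at this
        exact hx (mem_closedBall_zero_iff.2 ((le_max_left _ _).trans this))
      simp [this, indicator_of_notMem hx]
  refine ⟨∫ x, S.indicator (fun _ => C) x, fun t => ?_⟩
  have hint : Integrable fun x => g (x, t) :=
    hS.mono' (Continuous.aestronglyMeasurable (by fun_prop)) (Eventually.of_forall (hle t))
  exact ⟨hint, integral_mono hint.abs hS (hle t)⟩

lemma deriv_slice {Ψ : Euc N × ℝ → ℝ} (hΨ : ContDiff ℝ 1 Ψ) (x : Euc N) (t : ℝ) :
    deriv (fun s => Ψ (x, s)) t = fderiv ℝ Ψ (x, t) (0, 1) := by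
  have h1 : HasFDerivAt Ψ (fderiv ℝ Ψ (x, t)) (x, t) :=
    (hΨ.differentiable one_ne_zero).differentiableAt.hasFDerivAt
  have h2 : HasFDerivAt (fun s => Ψ (x, s)) _ t := h1.comp t (hasFDerivAt_prodMk_right x t)
  rw [h2.hasDerivAt.deriv]
  simp

variable {X : Type*} [MeasurableSpace X] {ν : Measure X}

/-- Passage to the limit in integrals of sums of products of boundedly convergent factors with
a fixed integrable function and with a sequence converging in `L¹`. -/
lemma tendsto_integral_mul_add_mul {v w A : ℕ → X → ℝ} {v' w' d A' : X → ℝ} {C M : ℝ}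
    (hv : ∀ n, AEStronglyMeasurable (v n) ν) (hw : ∀ n, AEStronglyMeasurable (w n) ν)
    (hvC : ∀ n, ∀ᵐ x ∂ν, |v n x| ≤ C) (hwM : ∀ n, ∀ᵐ x ∂ν, |w n x| ≤ M)
    (hvlim : ∀ᵐ x ∂ν, Tendsto (fun n => v n x) atTop (𝓝 (v' x)))
    (hwlim : ∀ᵐ x ∂ν, Tendsto (fun n => w n x) atTop (𝓝 (w' x)))
    (hd : Integrable d ν) (hA' : Integrable A' ν) (hA : ∀ n, Integrable (A n) ν)
    (hAlim : Tendsto (fun n => ∫ x, |A n x - A' x| ∂ν) atTop (𝓝 0)) :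
    Tendsto (fun n => ∫ x, (v n x * d x + w n x * A n x) ∂ν) atTop
      (𝓝 (∫ x, (v' x * d x + w' x * A' x) ∂ν)) := by
  have hvd : ∀ n, Integrable (fun x => v n x * d x) ν := fun n => hd.bdd_mul (hv n) (hvC n)
  have hwA' : ∀ n, Integrable (fun x => w n x * A' x) ν := fun n => hA'.bdd_mul (hw n) (hwM n)
  have hwA : ∀ n, Integrable (fun x => w n x * (A n x - A' x)) ν := fun n =>
    ((hA n).sub hA').bdd_mul (hw n) (hwM n)
  have hmain : Tendsto (fun n => ∫ x, (v n x * d x + w n x * A' x) ∂ν) atTop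
      (𝓝 (∫ x, (v' x * d x + w' x * A' x) ∂ν)) := by
    refine tendsto_integral_of_dominated_convergence (fun x => C * |d x| + M * |A' x|)
      (fun n => ((hvd n).add (hwA' n)).aestronglyMeasurable)
      ((hd.abs.const_mul C).add (hA'.abs.const_mul M)) (fun n => ?_) ?_
    · filter_upwards [hvC n, hwM n] with x h1 h2
      refine (norm_add_le _ _).trans ?_
      simp only [norm_mul, Real.norm_eq_abs]
      gcongr
    · filter_upwards [hvlim, hwlim] with x h1 h2
      exact (h1.mul_const _).add (h2.mul_const _)
  have herr : Tendsto (fun n => ∫ x, w n x * (A n x - A' x) ∂ν) atTop (𝓝 0) := by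
    refine squeeze_zero_norm (fun n => ?_) (by simpa using hAlim.const_mul M)
    rw [← integral_const_mul]
    refine norm_integral_le_of_norm_le (((hA n).sub hA').abs.const_mul M) ?_
    filter_upwards [hwM n] with x h2
    rw [norm_mul]
    exact mul_le_mul_of_nonneg_right h2 (abs_nonneg _)
  have hsum := hmain.add herr
  rw [add_zero] at hsum
  refine hsum.congr fun n => ?_
  refine (integral_add ((hvd n).add (hwA' n)) (hwA n)).symm.trans ?_
  refine integral_congr_ae (Eventually.of_forall fun x => ?_)
  simp only [Pi.add_apply]
  ring

lemma abs_integral_mul_add_mul_le {v w d A : X → ℝ} {C M : ℝ}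
    (hvC : ∀ᵐ x ∂ν, |v x| ≤ C) (hwM : ∀ᵐ x ∂ν, |w x| ≤ M)
    (hd : Integrable d ν) (hA : Integrable A ν) :
    |∫ x, (v x * d x + w x * A x) ∂ν| ≤ C * (∫ x, |d x| ∂ν) + M * ∫ x, |A x| ∂ν := by
  rw [← integral_const_mul, ← integral_const_mul,
    ← integral_add (hd.abs.const_mul C) (hA.abs.const_mul M)]
  rw [← Real.norm_eq_abs]
  refine norm_integral_le_of_norm_le ((hd.abs.const_mul C).add (hA.abs.const_mul M)) ?_
  filter_upwards [hvC, hwM] with x h1 h2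
  refine (norm_add_le _ _).trans ?_
  simp only [norm_mul, Real.norm_eq_abs]
  gcongr

/-- Pointwise convergent monotone functions are uniformly bounded on bounded intervals. -/
lemma exists_abs_le_of_monotone_of_tendsto {φs : ℕ → ℝ → ℝ} {φ : ℝ → ℝ}
    (hmono : ∀ n, Monotone (φs n)) (hlim : ∀ s, Tendsto (fun n => φs n s) atTop (𝓝 (φ s)))
    (C : ℝ) : ∃ M, 0 ≤ M ∧ ∀ n s, |s| ≤ C → |φs n s| ≤ M := by
  obtain ⟨M₁, h₁⟩ := (hlim C).abs.bddAbove_range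
  obtain ⟨M₂, h₂⟩ := (hlim (-C)).abs.bddAbove_range
  refine ⟨max M₁ M₂, ?_, fun n s hs => ?_⟩
  · exact ((abs_nonneg _).trans (h₁ (mem_range_self 0))).trans (le_max_left _ _)
  · refine (abs_le_max_abs_abs (hmono n (abs_le.1 hs).1) (hmono n (abs_le.1 hs).2)).trans ?_
    rw [max_comm]
    exact max_le_max (h₁ (mem_range_self n)) (h₂ (mem_range_self n))

lemma ae_ae_of_ae_QTvol {T : ℝ} {p : Euc N → ℝ → Prop}
    (h : ∀ᵐ q ∂(QTvol N T), p q.1 q.2) :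
    ∀ᵐ t ∂(volume.restrict (Ioo 0 T)), ∀ᵐ x : Euc N, p x t :=
  Measure.ae_ae_of_ae_prod (Measure.measurePreserving_swap.quasiMeasurePreserving.ae h)

end Stability

/-- Stability (Theorem 2.4). If `u_n` are uniformly bounded distributional
solutions of `∂_t u_n − L^{μ_n}[φ_n(u_n)] = 0` in `Q_T`, `L^{μ_n}[ψ] → L[ψ]` in `L¹` for every
test function, `φ_n → φ` locally uniformly, and `u_n → u` a.e. in `Q_T`, then `u` is a
distributional solution of `∂_t u − L[φ(u)] = 0` in `Q_T`. -/
theorem stability_of_distributional_solutions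
    (N : ℕ) (hN : 0 < N) (T : ℝ) (hT : 0 < T)
    (L : (Euc N → ℝ) → Euc N → ℝ)
    (hL : ∀ ψ : Euc N → ℝ, IsTestFn ψ → Integrable (L ψ) (volume : Measure (Euc N)))
    (μs : ℕ → Measure (Euc N)) (hμs : ∀ n, IsLevyMeasure (μs n))
    (φs : ℕ → ℝ → ℝ) (hφs : ∀ n, Continuous (φs n) ∧ Monotone (φs n))
    (φ : ℝ → ℝ) (hφ : Continuous φ ∧ Monotone φ)
    (us : ℕ → Euc N → ℝ → ℝ) (u : Euc N → ℝ → ℝ)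
    (husinf : ∀ n, MemLinfQT T (us n)) (huinf : MemLinfQT T u)
    (hsol : ∀ n, ∀ ψ : Euc N → ℝ → ℝ, IsIntTestFn T ψ →
      ∫ t in Set.Ioo (0 : ℝ) T, ∫ x,
        (us n x t * deriv (ψ x) t + φs n (us n x t) * Lop (μs n) (fun y => ψ y t) x) = 0)
    (hbdd : ∃ C : ℝ, ∀ n, ∀ᵐ p ∂(QTvol N T), |us n p.1 p.2| ≤ C)
    (hi : ∀ ψ : Euc N → ℝ, IsTestFn ψ →
      Tendsto (fun n => ∫ x, |Lop (μs n) ψ x - L ψ x|) atTop (nhds 0))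
    (hii : TendstoLocallyUniformly (fun n => φs n) φ atTop)
    (hiii : ∀ᵐ p ∂(QTvol N T), Tendsto (fun n => us n p.1 p.2) atTop (nhds (u p.1 p.2))) :
    ∀ ψ : Euc N → ℝ → ℝ, IsIntTestFn T ψ →
      ∫ t in Set.Ioo (0 : ℝ) T, ∫ x,
        (u x t * deriv (ψ x) t + φ (u x t) * L (fun y => ψ y t) x) = 0 := by
  intro ψ hψ
  have hsm := hψ.1
  have hcs := hψ.2.1
  obtain ⟨C, hC⟩ := hbdd
  set Ψ : Euc N × ℝ → ℝ := Function.uncurry ψ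
  have h2 : ContDiff ℝ 2 Ψ := by exact_mod_cast contDiff_infty.1 hsm 2
  have h1 : ContDiff ℝ 1 Ψ := h2.of_le (by norm_num)
  have hder : ∀ x t, deriv (ψ x) t = fderiv ℝ Ψ (x, t) (0, 1) := deriv_slice h1
  have hdc : Continuous fun p => fderiv ℝ Ψ p (0, 1) :=
    (h1.continuous_fderiv one_ne_zero).clm_apply continuous_const
  obtain ⟨K, R, hb⟩ := exists_levyBound_slice h2 hcs
  have htest : ∀ t, IsTestFn fun y => ψ y t := fun t =>
    ⟨hsm.comp (contDiff_id.prodMk contDiff_const),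
      HasCompactSupport.intro (isCompact_closedBall 0 R) fun x hx =>
        (hb t).eq_zero x (by simpa using hx)⟩
  obtain ⟨B, hB⟩ := exists_integral_abs_slice_le hdc (hcs.fderiv_apply ℝ (0, 1))
  obtain ⟨M, hM⟩ := exists_integral_min_le hμs hL hi
  have hφlim : ∀ s, Tendsto (fun n => φs n s) atTop (nhds (φ s)) := fun s =>
    hii.tendsto_comp hφ.1.continuousAt tendsto_const_nhds
  obtain ⟨P, hP0, hP⟩ := exists_abs_le_of_monotone_of_tendsto (fun n => (hφs n).2) hφlim |C|
  have hK := (hb 0).nonneg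
  have hbound := fun n => ae_ae_of_ae_QTvol (p := fun x t => |us n x t| ≤ |C|)
    ((hC n).mono fun p hp => hp.trans (le_abs_self C))
  have hswap : ∀ n, AEStronglyMeasurable (fun q : ℝ × Euc N => us n q.2 q.1)
      ((volume.restrict (Ioo 0 T)).prod volume) := fun n => (husinf n).1.prod_swap
  have hlim : Tendsto (fun n => ∫ t in Ioo (0 : ℝ) T, ∫ x,
        (us n x t * deriv (ψ x) t + φs n (us n x t) * Lop (μs n) (fun y => ψ y t) x))
      atTop (nhds (∫ t in Ioo (0 : ℝ) T, ∫ x,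
        (u x t * deriv (ψ x) t + φ (u x t) * L (fun y => ψ y t) x))) := by
    simp only [hder]
    refine tendsto_integral_of_dominated_convergence
      (fun _ => |C| * B + P * (M * (2 * K * volume.real (Metric.closedBall (0 : Euc N) (R + 1)))))
      (fun n => ?_) (integrable_const _) (fun n => ?_) ?_
    · have := (hμs n).sFinite
      refine AEStronglyMeasurable.integral_prod_right'
        (f := fun q : ℝ × Euc N => us n q.2 q.1 * fderiv ℝ Ψ (q.2, q.1) (0, 1) +
          φs n (us n q.2 q.1) * Lop (μs n) (fun y => ψ y q.1) q.2) ?_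
      have hLop : StronglyMeasurable fun q : ℝ × Euc N => Lop (μs n) (fun y => ψ y q.1) q.2 :=
        (stronglyMeasurable_Lop_slice (μ := μs n) h1).comp_measurable measurable_swap
      have hd : Continuous fun q : ℝ × Euc N => fderiv ℝ Ψ (q.2, q.1) (0, 1) :=
        hdc.comp continuous_swap
      exact ((hswap n).mul hd.aestronglyMeasurable).add
        (((hφs n).1.comp_aestronglyMeasurable (hswap n)).mul hLop.aestronglyMeasurable)
    · filter_upwards [hbound n] with t ht
      refine (abs_integral_mul_add_mul_le ht (ht.mono fun x hx => hP n _ hx) (hB t).1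
        ((hb t).integrable_Lop (hμs n))).trans ?_
      gcongr
      · exact (hB t).2
      · refine ((hb t).integral_abs_Lop_le (hμs n)).trans ?_
        gcongr
        exact hM n
    · filter_upwards [ae_all_iff.2 hbound, ae_all_iff.2 fun n => (hswap n).prodMk_left,
        ae_ae_of_ae_QTvol (p := fun x t => Tendsto (fun n => us n x t) atTop (nhds (u x t))) hiii]
        with t hbt hmt hlt
      exact tendsto_integral_mul_add_mul hmt
        (fun n => (hφs n).1.comp_aestronglyMeasurable (hmt n)) hbt
        (fun n => (hbt n).mono fun x hx => hP n _ hx) hlt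
        (hlt.mono fun x hx => hii.tendsto_comp hφ.1.continuousAt hx)
        (hB t).1 (hL _ (htest t)) (fun n => (hb t).integrable_Lop (hμs n)) (hi _ (htest t))
  refine tendsto_nhds_unique hlim ?_
  simp only [hsol _ ψ hψ, tendsto_const_nhds]
end
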